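/- arXiv:2109.08929 — 2 statements merged into one kernel-verified Lean document; each statement's English description precedes it below -/
import Mathlib

section
/- Let 2 < α < 3 and set R_α = ( (√π/2) · Γ((3-α)/2)/Γ((4-α)/2) · sin((α-1)π/2)/((α-1)π/2) )^{1/(α-2)}. Then the infimum E_α over all Borel probability measures μ on ℝ of the energy E_α[μ] = (1/2)∬_{ℝ×ℝ} ( α^{-1}|x-y|^α − 2^{-1}|x-y|^2 ) dμ(x) dμ(y) equals E_α = −((α−2)/(2α(4−α))) · R_α². Moreover, the infimum is attained at μ if and only if there exists a ∈ ℝ such that dμ(x) = C_α^{-1} R_α^{α-2} (R_α² − (x−a)²)^{−(α−1)/2} 𝟙(|x−a| < R_α) dx, where C_α = √π Γ((3-α)/2)/Γ((4-α)/2). -/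
open MeasureTheory Real

theorem hasIntegral_beta {a b : ℝ} (ha : 0 < a) (hb : 0 < b) :
    IntegrableOn (fun v : ℝ => v ^ (a - 1) * (1 - v) ^ (b - 1)) (Set.Ioo 0 1) ∧
    ∫ v in Set.Ioo (0 : ℝ) 1, v ^ (a - 1) * (1 - v) ^ (b - 1) = ProbabilityTheory.beta a b := by
  have h := ProbabilityTheory.lintegral_betaPDF_eq_one ha hb
  rw [ProbabilityTheory.lintegral_betaPDF] at h
  have hB := ProbabilityTheory.beta_pos ha hb
  set B := ProbabilityTheory.beta a b
  have hnn : 0 ≤ᵐ[volume.restrict (Set.Ioo (0 : ℝ) 1)]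
      fun v : ℝ => 1 / B * v ^ (a - 1) * (1 - v) ^ (b - 1) := by
    filter_upwards [ae_restrict_mem measurableSet_Ioo] with v hv
    have h1 : 0 < v := hv.1
    have h2 : 0 < 1 - v := by linarith [hv.2]
    simp only [Pi.zero_apply]
    positivity
  have hm : AEStronglyMeasurable (fun v : ℝ => 1 / B * v ^ (a - 1) * (1 - v) ^ (b - 1))
      (volume.restrict (Set.Ioo (0 : ℝ) 1)) := by
    apply Measurable.aestronglyMeasurable
    fun_prop
  have hint : Integrable (fun v : ℝ => 1 / B * v ^ (a - 1) * (1 - v) ^ (b - 1))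
      (volume.restrict (Set.Ioo (0 : ℝ) 1)) := by
    refine ⟨hm, ?_⟩
    rw [hasFiniteIntegral_iff_ofReal hnn, h]
    exact ENNReal.one_lt_top
  have hval : ∫ v in Set.Ioo (0 : ℝ) 1, 1 / B * v ^ (a - 1) * (1 - v) ^ (b - 1) = 1 := by
    rw [integral_eq_lintegral_of_nonneg_ae hnn hm, h]
    simp
  have heq : (fun v : ℝ => v ^ (a - 1) * (1 - v) ^ (b - 1)) =
      fun v => B * (1 / B * v ^ (a - 1) * (1 - v) ^ (b - 1)) := by
    funext v
    field_simp
  refine ⟨?_, ?_⟩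
  · rw [heq]
    exact hint.const_mul B
  · rw [heq, integral_const_mul, hval, mul_one]

theorem integral_Ioo_neg_one_one_of_even {f : ℝ → ℝ} (hf : ∀ x, f (-x) = f x)
    (hi : IntegrableOn f (Set.Ioo 0 1)) :
    IntegrableOn f (Set.Ioo (-1) 1) ∧
      ∫ u in Set.Ioo (-1 : ℝ) 1, f u = 2 * ∫ u in Set.Ioo (0 : ℝ) 1, f u := by
  have hI' : IntervalIntegrable f volume 0 1 := by
    rwa [intervalIntegrable_iff_integrableOn_Ioc_of_le (by norm_num),
      integrableOn_Ioc_iff_integrableOn_Ioo]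
  have hI : IntervalIntegrable f volume (-1) 0 := by
    rw [IntervalIntegrable.iff_comp_neg]
    simp only [hf, neg_zero, neg_neg]
    exact hI'.symm
  refine ⟨?_, ?_⟩
  · rw [← integrableOn_Ioc_iff_integrableOn_Ioo, ← intervalIntegrable_iff_integrableOn_Ioc_of_le
      (by norm_num)]
    exact hI.trans hI'
  · rw [← integral_Ioc_eq_integral_Ioo, ← integral_Ioc_eq_integral_Ioo,
      ← intervalIntegral.integral_of_le (by norm_num), ← intervalIntegral.integral_of_le
      (by norm_num), ← intervalIntegral.integral_add_adjacent_intervals hI hI', two_mul]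
    congr 1
    have := intervalIntegral.integral_comp_neg (a := 0) (b := 1) f
    simp only [hf, neg_zero] at this
    exact this.symm

theorem integral_abs_rpow_mul_one_sub_sq_rpow {p q : ℝ} (hp : -1 < p) (hq : 0 < q) :
    IntegrableOn (fun u : ℝ => |u| ^ p * (1 - u ^ 2) ^ (q - 1)) (Set.Ioo (-1) 1) ∧
    ∫ u in Set.Ioo (-1 : ℝ) 1, |u| ^ p * (1 - u ^ 2) ^ (q - 1) =
      ProbabilityTheory.beta ((p + 1) / 2) q := by
  obtain ⟨hi, hv⟩ := hasIntegral_beta (a := (p + 1) / 2) (b := q) (by linarith) hq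
  have himg : (fun u : ℝ => u ^ 2) '' Set.Ioo 0 1 = Set.Ioo 0 1 := by
    ext v
    simp only [Set.mem_image, Set.mem_Ioo]
    constructor
    · rintro ⟨u, ⟨h0, h1⟩, rfl⟩
      exact ⟨by positivity, by nlinarith⟩
    · rintro ⟨h0, h1⟩
      exact ⟨√v, ⟨Real.sqrt_pos.2 h0, by rw [Real.sqrt_lt' one_pos]; simpa using h1⟩,
        Real.sq_sqrt h0.le⟩
  have hder : ∀ u ∈ Set.Ioo (0 : ℝ) 1,
      HasDerivWithinAt (fun u : ℝ => u ^ 2) (2 * u) (Set.Ioo 0 1) u := by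
    intro u _
    simpa using (hasDerivAt_pow 2 u).hasDerivWithinAt
  have hinj : Set.InjOn (fun u : ℝ => u ^ 2) (Set.Ioo 0 1) := by
    intro u hu v hv h
    exact (pow_left_inj₀ hu.1.le hv.1.le two_ne_zero).1 h
  have hcongr : Set.EqOn (fun u : ℝ => |2 * u| •
      ((u ^ 2) ^ ((p + 1) / 2 - 1) * (1 - u ^ 2) ^ (q - 1)))
      (fun u => 2 * (|u| ^ p * (1 - u ^ 2) ^ (q - 1))) (Set.Ioo 0 1) := by
    intro u hu
    have hu0 : 0 < u := hu.1
    have h2 : (u ^ 2) ^ ((p + 1) / 2 - 1) * u = u ^ p := by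
      rw [← Real.rpow_natCast u 2, ← Real.rpow_mul hu0.le]
      nth_rewrite 2 [← Real.rpow_one u]
      rw [← Real.rpow_add hu0]
      congr 1
      push_cast
      ring
    simp only [smul_eq_mul]
    rw [abs_of_pos hu0, abs_of_pos (by positivity : 0 < 2 * u), ← h2]
    ring
  have hi2 := (integrableOn_image_iff_integrableOn_abs_deriv_smul measurableSet_Ioo hder hinj
    (fun v : ℝ => v ^ ((p + 1) / 2 - 1) * (1 - v) ^ (q - 1))).1 (by rwa [himg])
  have hv2 := integral_image_eq_integral_abs_deriv_smul measurableSet_Ioo hder hinj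
    (fun v : ℝ => v ^ ((p + 1) / 2 - 1) * (1 - v) ^ (q - 1))
  rw [himg, hv, setIntegral_congr_fun measurableSet_Ioo hcongr, integral_const_mul] at hv2
  have hi3 : IntegrableOn (fun u : ℝ => |u| ^ p * (1 - u ^ 2) ^ (q - 1)) (Set.Ioo 0 1) := by
    have := ((integrableOn_congr_fun hcongr measurableSet_Ioo).1 hi2).const_mul (1 / 2)
    refine this.congr (Filter.Eventually.of_forall fun u => ?_)
    ring
  have := integral_Ioo_neg_one_one_of_even
    (f := fun u : ℝ => |u| ^ p * (1 - u ^ 2) ^ (q - 1)) (by simp) hi3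
  rw [hv2]
  exact this

theorem one_add_mul_pos_of_mem_Ioo {x u : ℝ} (hx : x ∈ Set.Ioo (-1 : ℝ) 1)
    (hu : u ∈ Set.Ioo (-1 : ℝ) 1) : 0 < 1 + x * u := by
  nlinarith [hx.1, hx.2, hu.1, hu.2, mul_pos (sub_pos.2 hx.1) (sub_pos.2 hu.1),
    mul_pos (sub_pos.2 hx.2) (sub_pos.2 hu.2), mul_pos (sub_pos.2 hx.2) (sub_pos.2 hu.1),
    mul_pos (sub_pos.2 hx.1) (sub_pos.2 hu.2)]

theorem mem_Ioo_neg_one_one_iff {x : ℝ} : x ∈ Set.Ioo (-1 : ℝ) 1 ↔ 0 < 1 - x ^ 2 := by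
  rw [sub_pos, sq_lt_one_iff_abs_lt_one, abs_lt, Set.mem_Ioo]

theorem one_sub_sq_mobius {x u : ℝ} (h : 1 + x * u ≠ 0) :
    1 - ((x + u) / (1 + x * u)) ^ 2 = (1 - x ^ 2) * (1 - u ^ 2) / (1 + x * u) ^ 2 := by
  field_simp
  ring

theorem mobius_mem {x u : ℝ} (hx : x ∈ Set.Ioo (-1 : ℝ) 1) (hu : u ∈ Set.Ioo (-1 : ℝ) 1) :
    (x + u) / (1 + x * u) ∈ Set.Ioo (-1 : ℝ) 1 := by
  have h := one_add_mul_pos_of_mem_Ioo hx hu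
  rw [mem_Ioo_neg_one_one_iff, one_sub_sq_mobius h.ne']
  have := mem_Ioo_neg_one_one_iff.1 hx
  have := mem_Ioo_neg_one_one_iff.1 hu
  positivity

theorem mobius_mobius_neg {x u : ℝ} (hx : x ∈ Set.Ioo (-1 : ℝ) 1) (hu : u ∈ Set.Ioo (-1 : ℝ) 1) :
    (-x + (x + u) / (1 + x * u)) / (1 + -x * ((x + u) / (1 + x * u))) = u := by
  have h := (one_add_mul_pos_of_mem_Ioo hx hu).ne'
  have h2 := (mem_Ioo_neg_one_one_iff.1 hx).ne'
  have e1 : -x + (x + u) / (1 + x * u) = u * (1 - x ^ 2) / (1 + x * u) := by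
    field_simp
    ring
  have e2 : 1 + -x * ((x + u) / (1 + x * u)) = (1 - x ^ 2) / (1 + x * u) := by
    field_simp
    ring
  rw [e1, e2, div_div_div_cancel_right₀ h, mul_div_cancel_right₀ _ h2]

theorem neg_mem_Ioo {x : ℝ} (hx : x ∈ Set.Ioo (-1 : ℝ) 1) : -x ∈ Set.Ioo (-1 : ℝ) 1 :=
  ⟨by linarith [hx.2], by linarith [hx.1]⟩

theorem bijOn_mobius {x : ℝ} (hx : x ∈ Set.Ioo (-1 : ℝ) 1) :
    Set.BijOn (fun u => (x + u) / (1 + x * u)) (Set.Ioo (-1) 1) (Set.Ioo (-1) 1) := by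
  refine Set.InvOn.bijOn (f' := fun u => (-x + u) / (1 + -x * u)) ⟨?_, ?_⟩ ?_ ?_
  · intro u hu
    exact mobius_mobius_neg hx hu
  · intro u hu
    have := mobius_mobius_neg (neg_mem_Ioo hx) hu
    simpa only [neg_neg] using this
  · intro u hu
    exact mobius_mem hx hu
  · intro u hu
    exact mobius_mem (neg_mem_Ioo hx) hu

theorem integral_abs_sub_rpow_mobius {s x : ℝ} (hx : x ∈ Set.Ioo (-1 : ℝ) 1) :
    ∫ y in Set.Ioo (-1 : ℝ) 1, |x - y| ^ s * (1 - y ^ 2) ^ ((1 - s) / 2 - 1) =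
      (1 - x ^ 2) ^ ((1 + s) / 2) * ∫ u in Set.Ioo (-1 : ℝ) 1,
        |u| ^ s * (1 - u ^ 2) ^ ((1 - s) / 2 - 1) * (1 + x * u)⁻¹ := by
  have hder : ∀ u ∈ Set.Ioo (-1 : ℝ) 1, HasDerivWithinAt (fun u => (x + u) / (1 + x * u))
      ((1 - x ^ 2) / (1 + x * u) ^ 2) (Set.Ioo (-1) 1) u := by
    intro u hu
    have h := (one_add_mul_pos_of_mem_Ioo hx hu).ne'
    have h1 : HasDerivAt (fun u => x + u) 1 u := (hasDerivAt_id u).const_add x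
    have h2 : HasDerivAt (fun u => 1 + x * u) x u := by
      simpa using ((hasDerivAt_id u).const_mul x).const_add 1
    refine ((h1.div h2 h).congr_deriv ?_).hasDerivWithinAt
    ring
  have hb := bijOn_mobius hx
  have h := integral_image_eq_integral_abs_deriv_smul measurableSet_Ioo hder hb.injOn
    (fun y => |x - y| ^ s * (1 - y ^ 2) ^ ((1 - s) / 2 - 1))
  rw [hb.image_eq] at h
  rw [h, ← integral_const_mul]
  refine setIntegral_congr_fun measurableSet_Ioo fun u hu => ?_
  have hp := one_add_mul_pos_of_mem_Ioo hx hu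
  have hX := mem_Ioo_neg_one_one_iff.1 hx
  have hU := mem_Ioo_neg_one_one_iff.1 hu
  have e1 : x - (x + u) / (1 + x * u) = -u * ((1 - x ^ 2) / (1 + x * u)) := by
    field_simp
    ring
  simp only [smul_eq_mul]
  rw [one_sub_sq_mobius hp.ne', e1, abs_mul, abs_neg, abs_of_pos (div_pos hX hp),
    Real.mul_rpow (abs_nonneg u) (by positivity), Real.div_rpow hX.le hp.le,
    Real.div_rpow (by positivity) (by positivity), Real.mul_rpow hX.le hU.le,
    abs_of_pos (by positivity), ← Real.rpow_natCast (1 + x * u) 2, ← Real.rpow_mul hp.le]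
  have e2 : (1 - x ^ 2) ^ ((1 + s) / 2) =
      (1 - x ^ 2) * (1 - x ^ 2) ^ s * (1 - x ^ 2) ^ ((1 - s) / 2 - 1) := by
    nth_rewrite 2 [← Real.rpow_one (1 - x ^ 2)]
    rw [← Real.rpow_add hX, ← Real.rpow_add hX]
    congr 1
    ring
  have e3 : (1 + x * u)⁻¹ = ((1 + x * u) ^ ((2 : ℕ) : ℝ))⁻¹ * ((1 + x * u) ^ s)⁻¹ *
      ((1 + x * u) ^ (((2 : ℕ) : ℝ) * ((1 - s) / 2 - 1)))⁻¹ := by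
    rw [← Real.rpow_neg hp.le, ← Real.rpow_neg hp.le, ← Real.rpow_neg hp.le, ← Real.rpow_add hp,
      ← Real.rpow_add hp, ← Real.rpow_neg_one]
    congr 1
    push_cast
    ring
  rw [e2, e3]
  ring

theorem bijOn_scale {x : ℝ} (hx : x ∈ Set.Ioo (-1 : ℝ) 1) :
    Set.BijOn (fun v => v / √(1 - x ^ 2 + x ^ 2 * v ^ 2)) (Set.Ioo (-1) 1) (Set.Ioo (-1) 1) := by
  have hX := mem_Ioo_neg_one_one_iff.1 hx
  refine Set.InvOn.bijOn (f' := fun u => u * √(1 - x ^ 2) / √(1 - x ^ 2 * u ^ 2)) ⟨?_, ?_⟩ ?_ ?_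
  · intro v hv
    have hD : 0 < 1 - x ^ 2 + x ^ 2 * v ^ 2 := by positivity
    have e : 1 - x ^ 2 * (v / √(1 - x ^ 2 + x ^ 2 * v ^ 2)) ^ 2 =
        (1 - x ^ 2) / (1 - x ^ 2 + x ^ 2 * v ^ 2) := by
      rw [div_pow, Real.sq_sqrt hD.le]
      field_simp
      ring
    have h1 := Real.sqrt_pos.2 hD
    have h2 := Real.sqrt_pos.2 hX
    simp only
    rw [e, Real.sqrt_div hX.le]
    field_simp
  · intro u hu
    have hU := mem_Ioo_neg_one_one_iff.1 hu
    have hD : 0 < 1 - x ^ 2 * u ^ 2 := by nlinarith [sq_nonneg x]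
    have e : 1 - x ^ 2 + x ^ 2 * (u * √(1 - x ^ 2) / √(1 - x ^ 2 * u ^ 2)) ^ 2 =
        (1 - x ^ 2) / (1 - x ^ 2 * u ^ 2) := by
      rw [div_pow, mul_pow, Real.sq_sqrt hD.le, Real.sq_sqrt hX.le]
      field_simp
      ring
    have h1 := Real.sqrt_pos.2 hD
    have h2 := Real.sqrt_pos.2 hX
    simp only
    rw [e, Real.sqrt_div hX.le, div_div_div_cancel_right₀ h1.ne', mul_div_cancel_right₀ _ h2.ne']
  · intro v hv
    have hV := mem_Ioo_neg_one_one_iff.1 hv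
    have hD : 0 < 1 - x ^ 2 + x ^ 2 * v ^ 2 := by positivity
    rw [mem_Ioo_neg_one_one_iff, div_pow, Real.sq_sqrt hD.le, sub_pos, div_lt_one hD]
    nlinarith
  · intro u hu
    have hU := mem_Ioo_neg_one_one_iff.1 hu
    have hD : 0 < 1 - x ^ 2 * u ^ 2 := by nlinarith [sq_nonneg x]
    rw [mem_Ioo_neg_one_one_iff, div_pow, mul_pow, Real.sq_sqrt hD.le, Real.sq_sqrt hX.le,
      sub_pos, div_lt_one hD]
    nlinarith

theorem integral_scale {s x : ℝ} (hx : x ∈ Set.Ioo (-1 : ℝ) 1) :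
    ∫ u in Set.Ioo (-1 : ℝ) 1,
        |u| ^ s * (1 - u ^ 2) ^ ((1 - s) / 2 - 1) * (1 - x ^ 2 * u ^ 2)⁻¹ =
      (1 - x ^ 2) ^ ((1 - s) / 2 - 1) * ∫ v in Set.Ioo (-1 : ℝ) 1,
        |v| ^ s * (1 - v ^ 2) ^ ((1 - s) / 2 - 1) := by
  have hX := mem_Ioo_neg_one_one_iff.1 hx
  have hder : ∀ v ∈ Set.Ioo (-1 : ℝ) 1,
      HasDerivWithinAt (fun v => v / √(1 - x ^ 2 + x ^ 2 * v ^ 2))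
        ((1 - x ^ 2) / ((1 - x ^ 2 + x ^ 2 * v ^ 2) * √(1 - x ^ 2 + x ^ 2 * v ^ 2)))
        (Set.Ioo (-1) 1) v := by
    intro v hv
    have hD : 0 < 1 - x ^ 2 + x ^ 2 * v ^ 2 := by positivity
    have h2 : HasDerivAt (fun v => 1 - x ^ 2 + x ^ 2 * v ^ 2) (x ^ 2 * (2 * v)) v := by
      simpa using ((hasDerivAt_pow 2 v).const_mul (x ^ 2)).const_add (1 - x ^ 2)
    have h3 := h2.sqrt hD.ne'
    have h4 := Real.sqrt_pos.2 hD
    refine (((hasDerivAt_id v).div h3 h4.ne').congr_deriv ?_).hasDerivWithinAt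
    have h5 := Real.sq_sqrt hD.le
    simp only [id]
    set r := √(1 - x ^ 2 + x ^ 2 * v ^ 2)
    rw [← h5]
    field_simp
    linarith
  have hb := bijOn_scale hx
  have h := integral_image_eq_integral_abs_deriv_smul measurableSet_Ioo hder hb.injOn
    (fun u => |u| ^ s * (1 - u ^ 2) ^ ((1 - s) / 2 - 1) * (1 - x ^ 2 * u ^ 2)⁻¹)
  rw [hb.image_eq] at h
  rw [h, ← integral_const_mul]
  refine setIntegral_congr_fun measurableSet_Ioo fun v hv => ?_
  have hV := mem_Ioo_neg_one_one_iff.1 hv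
  have hD : 0 < 1 - x ^ 2 + x ^ 2 * v ^ 2 := by positivity
  have e1 : 1 - (v / √(1 - x ^ 2 + x ^ 2 * v ^ 2)) ^ 2 =
      (1 - x ^ 2) * (1 - v ^ 2) / (1 - x ^ 2 + x ^ 2 * v ^ 2) := by
    rw [div_pow, Real.sq_sqrt hD.le]
    field_simp
    ring
  have e2 : 1 - x ^ 2 * (v / √(1 - x ^ 2 + x ^ 2 * v ^ 2)) ^ 2 =
      (1 - x ^ 2) / (1 - x ^ 2 + x ^ 2 * v ^ 2) := by
    rw [div_pow, Real.sq_sqrt hD.le]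
    field_simp
    ring
  simp only [smul_eq_mul]
  rw [e1, e2, abs_div v, abs_of_nonneg (Real.sqrt_nonneg _), abs_of_pos (by positivity),
    Real.div_rpow (abs_nonneg v) (by positivity), Real.div_rpow (by positivity) hD.le,
    Real.mul_rpow hX.le hV.le]
  set D := 1 - x ^ 2 + x ^ 2 * v ^ 2
  rw [Real.sqrt_eq_rpow, ← Real.rpow_mul hD.le]
  have e3 : (D ^ (1 / 2 : ℝ)) * D ^ (1 / 2 * s) * D ^ ((1 - s) / 2 - 1) = 1 := by
    rw [← Real.rpow_add hD, ← Real.rpow_add hD]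
    convert Real.rpow_zero D using 2
    ring
  have p1 := Real.rpow_pos_of_pos hD (1 / 2)
  have p2 := Real.rpow_pos_of_pos hD (1 / 2 * s)
  have p3 := Real.rpow_pos_of_pos hD ((1 - s) / 2 - 1)
  generalize D ^ (1 / 2 : ℝ) = a at *
  generalize D ^ (1 / 2 * s) = b at *
  generalize D ^ ((1 - s) / 2 - 1) = c at *
  generalize |v| ^ s = d
  generalize (1 - x ^ 2) ^ ((1 - s) / 2 - 1) = e
  generalize (1 - v ^ 2) ^ ((1 - s) / 2 - 1) = f
  field_simp
  linear_combination (-(d * e * f)) * e3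

theorem integral_abs_sub_rpow_eq {s x : ℝ} (hs0 : 0 < s) (hs1 : s < 1)
    (hx : x ∈ Set.Ioo (-1 : ℝ) 1) :
    ∫ y in Set.Ioo (-1 : ℝ) 1, |x - y| ^ s * (1 - y ^ 2) ^ ((1 - s) / 2 - 1) =
      ProbabilityTheory.beta ((s + 1) / 2) ((1 - s) / 2) := by
  obtain ⟨hi, hv⟩ := integral_abs_rpow_mul_one_sub_sq_rpow (p := s) (q := (1 - s) / 2)
    (by linarith) (by linarith)
  have hX := mem_Ioo_neg_one_one_iff.1 hx
  have hint : ∀ t ∈ Set.Ioo (-1 : ℝ) 1, IntegrableOn (fun u =>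
      |u| ^ s * (1 - u ^ 2) ^ ((1 - s) / 2 - 1) * (1 + t * u)⁻¹) (Set.Ioo (-1) 1) := by
    intro t ht
    refine Integrable.mul_bdd (c := (1 - |t|)⁻¹) hi ?_ ?_
    · apply Measurable.aestronglyMeasurable
      fun_prop
    · filter_upwards [ae_restrict_mem measurableSet_Ioo] with u hu
      have h1 := one_add_mul_pos_of_mem_Ioo ht hu
      have h2 : |t| < 1 := abs_lt.2 ht
      have h3 : |u| < 1 := abs_lt.2 hu
      rw [Real.norm_of_nonneg (by positivity)]
      apply inv_anti₀ (by linarith)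
      have h4 := neg_abs_le (t * u)
      rw [abs_mul] at h4
      nlinarith [abs_nonneg t]
  have hflip : ∫ u in Set.Ioo (-1 : ℝ) 1,
        |u| ^ s * (1 - u ^ 2) ^ ((1 - s) / 2 - 1) * (1 + x * u)⁻¹ =
      ∫ u in Set.Ioo (-1 : ℝ) 1,
        |u| ^ s * (1 - u ^ 2) ^ ((1 - s) / 2 - 1) * (1 + -x * u)⁻¹ := by
    rw [← integral_Ioc_eq_integral_Ioo, ← integral_Ioc_eq_integral_Ioo,
      ← intervalIntegral.integral_of_le (by norm_num),
      ← intervalIntegral.integral_of_le (by norm_num)]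
    have := intervalIntegral.integral_comp_neg (a := -1) (b := 1)
      (fun u : ℝ => |u| ^ s * (1 - u ^ 2) ^ ((1 - s) / 2 - 1) * (1 + x * u)⁻¹)
    simp only [neg_neg] at this
    rw [← this]
    simp
  have hsum : ∫ u in Set.Ioo (-1 : ℝ) 1,
        |u| ^ s * (1 - u ^ 2) ^ ((1 - s) / 2 - 1) * (1 + x * u)⁻¹ =
      ∫ u in Set.Ioo (-1 : ℝ) 1,
        |u| ^ s * (1 - u ^ 2) ^ ((1 - s) / 2 - 1) * (1 - x ^ 2 * u ^ 2)⁻¹ := by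
    have h2 := integral_add (hint x hx) (hint (-x) (neg_mem_Ioo hx))
    rw [← hflip, ← two_mul] at h2
    have h3 : ∫ u in Set.Ioo (-1 : ℝ) 1,
        (|u| ^ s * (1 - u ^ 2) ^ ((1 - s) / 2 - 1) * (1 + x * u)⁻¹ +
          |u| ^ s * (1 - u ^ 2) ^ ((1 - s) / 2 - 1) * (1 + -x * u)⁻¹) =
        2 * ∫ u in Set.Ioo (-1 : ℝ) 1,
          |u| ^ s * (1 - u ^ 2) ^ ((1 - s) / 2 - 1) * (1 - x ^ 2 * u ^ 2)⁻¹ := by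
      rw [← integral_const_mul]
      refine setIntegral_congr_fun measurableSet_Ioo fun u hu => ?_
      have h4 := one_add_mul_pos_of_mem_Ioo hx hu
      have h5 := one_add_mul_pos_of_mem_Ioo (neg_mem_Ioo hx) hu
      have e : 1 - x ^ 2 * u ^ 2 = (1 + x * u) * (1 + -x * u) := by ring
      have e' : (1 + x * u)⁻¹ + (1 + -x * u)⁻¹ = 2 * ((1 + x * u) * (1 + -x * u))⁻¹ := by
        rw [inv_add_inv h4.ne' h5.ne', ← div_eq_mul_inv]
        ring
      rw [e, ← mul_add, e']
      ring
    rw [h3] at h2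
    linarith
  rw [integral_abs_sub_rpow_mobius hx, hsum, integral_scale hx, ← mul_assoc, ← Real.rpow_add hX, hv]
  have : (1 + s) / 2 + ((1 - s) / 2 - 1) = 0 := by ring
  rw [this, Real.rpow_zero, one_mul]

theorem integrableOn_comp_sub_mul {w k : ℝ → ℝ} (hw : IntegrableOn w (Set.Ioo (-1) 1))
    (hk : Continuous k) (x : ℝ) : IntegrableOn (fun y => k (x - y) * w y) (Set.Ioo (-1) 1) := by
  obtain ⟨C, hC⟩ := (isCompact_Icc (a := x - 1) (b := x + 1)).exists_bound_of_continuousOn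
    hk.continuousOn
  refine Integrable.bdd_mul (c := C) hw ?_ ?_
  · exact (hk.comp (continuous_const.sub continuous_id)).aestronglyMeasurable
  · filter_upwards [ae_restrict_mem measurableSet_Ioo] with y hy
    exact hC _ ⟨by linarith [hy.2], by linarith [hy.1]⟩

theorem continuous_integral_comp_sub_mul {w k : ℝ → ℝ} (hw : IntegrableOn w (Set.Ioo (-1) 1))
    (hk : Continuous k) : Continuous fun x => ∫ y in Set.Ioo (-1 : ℝ) 1, k (x - y) * w y := by
  rw [continuous_iff_continuousAt]
  intro x
  obtain ⟨C, hC⟩ := (isCompact_Icc (a := x - 2) (b := x + 2)).exists_bound_of_continuousOn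
    hk.continuousOn
  refine continuousAt_of_dominated (bound := fun y => C * ‖w y‖) ?_ ?_ (hw.norm.const_mul C) ?_
  · exact Filter.Eventually.of_forall fun z =>
      (integrableOn_comp_sub_mul hw hk z).aestronglyMeasurable
  · filter_upwards [Icc_mem_nhds (sub_one_lt x) (lt_add_one x)] with z hz
    filter_upwards [ae_restrict_mem measurableSet_Ioo] with y hy
    rw [norm_mul]
    exact mul_le_mul_of_nonneg_right
      (hC _ ⟨by linarith [hy.2, hz.1], by linarith [hy.1, hz.2]⟩) (norm_nonneg _)
  · refine Filter.Eventually.of_forall fun y => ?_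
    exact ((hk.comp (continuous_id.sub continuous_const)).mul continuous_const).continuousAt

theorem hasDerivAt_integral_comp_sub_mul {w k k' : ℝ → ℝ}
    (hw : IntegrableOn w (Set.Ioo (-1) 1)) (hk : ∀ u, HasDerivAt k (k' u) u)
    (hk' : Continuous k') (x : ℝ) :
    HasDerivAt (fun x => ∫ y in Set.Ioo (-1 : ℝ) 1, k (x - y) * w y)
      (∫ y in Set.Ioo (-1 : ℝ) 1, k' (x - y) * w y) x := by
  have hkc : Continuous k := continuous_iff_continuousAt.2 fun u => (hk u).continuousAt
  obtain ⟨C, hC⟩ := (isCompact_Icc (a := x - 2) (b := x + 2)).exists_bound_of_continuousOn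
    hk'.continuousOn
  refine (hasDerivAt_integral_of_dominated_loc_of_deriv_le (bound := fun y => C * ‖w y‖)
    (μ := volume.restrict (Set.Ioo (-1) 1)) (F := fun x y => k (x - y) * w y)
    (F' := fun x y => k' (x - y) * w y)
    (Icc_mem_nhds (sub_one_lt x) (lt_add_one x)) ?_ (integrableOn_comp_sub_mul hw hkc x) ?_ ?_
    (hw.norm.const_mul C) ?_).2
  · exact Filter.Eventually.of_forall fun z =>
      (integrableOn_comp_sub_mul hw hkc z).aestronglyMeasurable
  · exact (integrableOn_comp_sub_mul hw hk' x).aestronglyMeasurable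
  · filter_upwards [ae_restrict_mem measurableSet_Ioo] with y hy
    intro z hz
    rw [norm_mul]
    exact mul_le_mul_of_nonneg_right
      (hC _ ⟨by linarith [hy.2, hz.1], by linarith [hy.1, hz.2]⟩) (norm_nonneg _)
  · refine Filter.Eventually.of_forall fun y z _ => ?_
    have h1 : HasDerivAt (fun z => z - y) 1 z := (hasDerivAt_id z).sub_const y
    have h2 := (hk (z - y)).comp z h1
    rw [mul_one] at h2
    exact h2.mul_const (w y)

theorem le_of_second_deriv_nonneg {f f' f'' : ℝ → ℝ} {x : ℝ} (hx : 0 ≤ x)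
    (hf : ∀ t, HasDerivAt f (f' t) t) (hf' : ∀ t, HasDerivAt f' (f'' t) t) (h0 : f' 0 = 0)
    (hnn : ∀ t, 0 ≤ t → t ≤ x → 0 ≤ f'' t) : f 0 ≤ f x := by
  have hm' : MonotoneOn f' (Set.Icc 0 x) := by
    refine monotoneOn_of_deriv_nonneg (convex_Icc 0 x)
      (fun t _ => (hf' t).continuousAt.continuousWithinAt)
      (fun t _ => (hf' t).differentiableAt.differentiableWithinAt) fun t ht => ?_
    rw [(hf' t).deriv]
    have := interior_subset ht
    exact hnn t this.1 this.2
  have hm : MonotoneOn f (Set.Icc 0 x) := by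
    refine monotoneOn_of_deriv_nonneg (convex_Icc 0 x)
      (fun t _ => (hf t).continuousAt.continuousWithinAt)
      (fun t _ => (hf t).differentiableAt.differentiableWithinAt) fun t ht => ?_
    rw [(hf t).deriv, ← h0]
    have := interior_subset ht
    exact hm' ⟨le_rfl, hx⟩ this this.1
  exact hm ⟨le_rfl, hx⟩ ⟨hx, le_rfl⟩ hx

theorem continuous_abs_rpow {s : ℝ} (hs : 0 ≤ s) : Continuous fun u : ℝ => |u| ^ s :=
  continuous_abs.rpow_const fun _ => Or.inr hs

theorem hasDerivAt_abs_rpow_mul_self {s : ℝ} (hs : 0 < s) (x : ℝ) :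
    HasDerivAt (fun u : ℝ => |u| ^ s * u) ((s + 1) * |x| ^ s) x := by
  refine hasDerivAt_of_hasDerivAt_of_ne' (x := 0) (g := fun u => (s + 1) * |u| ^ s) ?_ ?_ ?_ x
  · intro y hy
    have h1 := ((hasDerivAt_abs hy).rpow_const (p := s) (Or.inl (abs_ne_zero.2 hy))).mul
      (hasDerivAt_id y)
    refine h1.congr_deriv ?_
    have h2 : |y| ^ (s - 1) * |y| = |y| ^ s := by
      nth_rewrite 2 [← Real.rpow_one |y|]
      rw [← Real.rpow_add (abs_pos.2 hy)]
      congr 1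
      ring
    have h3 : (SignType.sign y : ℝ) * y = |y| := sign_mul_self y
    simp only [id, mul_one]
    linear_combination s * |y| ^ (s - 1) * h3 + s * h2
  · exact ((continuous_abs_rpow hs.le).mul continuous_id).continuousAt
  · exact (continuous_const.mul (continuous_abs_rpow hs.le)).continuousAt

theorem integrableOn_weight {s : ℝ} (hs1 : s < 1) :
    IntegrableOn (fun y : ℝ => (1 - y ^ 2) ^ ((1 - s) / 2 - 1)) (Set.Ioo (-1) 1) := by
  have := (integral_abs_rpow_mul_one_sub_sq_rpow (p := 0) (q := (1 - s) / 2)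
    (by norm_num) (by linarith)).1
  simpa using this

theorem le_integral_abs_sub_rpow {s x : ℝ} (hs0 : 0 < s) (hs1 : s < 1) (hx : 0 ≤ x) :
    ProbabilityTheory.beta ((s + 1) / 2) ((1 - s) / 2) ≤
      ∫ y in Set.Ioo (-1 : ℝ) 1, |x - y| ^ s * (1 - y ^ 2) ^ ((1 - s) / 2 - 1) := by
  have hw := integrableOn_weight hs1
  have hk := continuous_abs_rpow hs0.le
  rcases lt_or_ge x 1 with h | h
  · exact (integral_abs_sub_rpow_eq hs0 hs1 ⟨by linarith, h⟩).ge
  have hone : ∫ y in Set.Ioo (-1 : ℝ) 1, |1 - y| ^ s * (1 - y ^ 2) ^ ((1 - s) / 2 - 1) =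
      ProbabilityTheory.beta ((s + 1) / 2) ((1 - s) / 2) := by
    have hc := continuous_integral_comp_sub_mul hw hk
    have hE : Set.EqOn (fun x => ∫ y in Set.Ioo (-1 : ℝ) 1,
        |x - y| ^ s * (1 - y ^ 2) ^ ((1 - s) / 2 - 1))
        (fun _ => ProbabilityTheory.beta ((s + 1) / 2) ((1 - s) / 2)) (Set.Ioo (-1) 1) :=
      fun t ht => integral_abs_sub_rpow_eq hs0 hs1 ht
    have := hE.closure hc continuous_const
    rw [closure_Ioo (by norm_num)] at this
    exact this ⟨by norm_num, le_rfl⟩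
  rw [← hone]
  refine setIntegral_mono_on (integrableOn_comp_sub_mul hw hk 1) (integrableOn_comp_sub_mul hw hk x)
    measurableSet_Ioo fun y hy => ?_
  have hY := mem_Ioo_neg_one_one_iff.1 hy
  refine mul_le_mul_of_nonneg_right ?_ (Real.rpow_nonneg hY.le _)
  refine Real.rpow_le_rpow (abs_nonneg _) ?_ hs0.le
  rw [abs_of_pos (by linarith [hy.2]), abs_of_pos (by linarith [hy.2])]
  linarith

theorem setIntegral_Ioo_comp_neg (f : ℝ → ℝ) :
    ∫ y in Set.Ioo (-1 : ℝ) 1, f (-y) = ∫ y in Set.Ioo (-1 : ℝ) 1, f y := by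
  rw [← integral_Ioc_eq_integral_Ioo, ← integral_Ioc_eq_integral_Ioo,
    ← intervalIntegral.integral_of_le (by norm_num),
    ← intervalIntegral.integral_of_le (by norm_num), intervalIntegral.integral_comp_neg, neg_neg]

theorem integral_abs_sub_rpow_add_two {s : ℝ} (hs0 : 0 < s) (hs1 : s < 1) (x : ℝ) :
    (ProbabilityTheory.beta ((s + 3) / 2) ((1 - s) / 2) +
        (s + 2) * (s + 1) / 2 * ProbabilityTheory.beta ((s + 1) / 2) ((1 - s) / 2) * x ^ 2 ≤
      ∫ y in Set.Ioo (-1 : ℝ) 1, |x - y| ^ (s + 2) * (1 - y ^ 2) ^ ((1 - s) / 2 - 1)) ∧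
    (|x| < 1 → ∫ y in Set.Ioo (-1 : ℝ) 1, |x - y| ^ (s + 2) * (1 - y ^ 2) ^ ((1 - s) / 2 - 1) =
      ProbabilityTheory.beta ((s + 3) / 2) ((1 - s) / 2) +
        (s + 2) * (s + 1) / 2 * ProbabilityTheory.beta ((s + 1) / 2) ((1 - s) / 2) * x ^ 2) := by
  have hw := integrableOn_weight hs1
  have hP0 := (integral_abs_rpow_mul_one_sub_sq_rpow (p := s + 2) (q := (1 - s) / 2)
    (by linarith) (by linarith)).2
  rw [show (s + 2 + 1) / 2 = (s + 3) / 2 by ring] at hP0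
  set B := ProbabilityTheory.beta ((s + 1) / 2) ((1 - s) / 2) with hB
  set P : ℝ → ℝ := fun x =>
    ∫ y in Set.Ioo (-1 : ℝ) 1, |x - y| ^ (s + 2) * (1 - y ^ 2) ^ ((1 - s) / 2 - 1) with hP
  set P' : ℝ → ℝ := fun x => ∫ y in Set.Ioo (-1 : ℝ) 1,
    (s + 2) * (|x - y| ^ s * (x - y)) * (1 - y ^ 2) ^ ((1 - s) / 2 - 1) with hP'
  set P'' : ℝ → ℝ := fun x => ∫ y in Set.Ioo (-1 : ℝ) 1,
    (s + 2) * ((s + 1) * |x - y| ^ s) * (1 - y ^ 2) ^ ((1 - s) / 2 - 1) with hP''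
  have hcs := continuous_abs_rpow hs0.le
  have d1 : ∀ t, HasDerivAt P (P' t) t := by
    refine hasDerivAt_integral_comp_sub_mul (k := fun u => |u| ^ (s + 2))
      (k' := fun u => (s + 2) * (|u| ^ s * u)) hw ?_ ?_
    · intro u
      refine (hasDerivAt_abs_rpow u (by linarith : 1 < s + 2)).congr_deriv ?_
      rw [show s + 2 - 2 = s by ring, mul_assoc]
    · exact continuous_const.mul (hcs.mul continuous_id)
  have d2 : ∀ t, HasDerivAt P' (P'' t) t := by
    refine hasDerivAt_integral_comp_sub_mul (k := fun u => (s + 2) * (|u| ^ s * u))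
      (k' := fun u => (s + 2) * ((s + 1) * |u| ^ s)) hw ?_ ?_
    · intro u
      exact (hasDerivAt_abs_rpow_mul_self hs0 u).const_mul (s + 2)
    · exact continuous_const.mul (continuous_const.mul hcs)
  have hP'0 : P' 0 = 0 := by
    have := setIntegral_Ioo_comp_neg fun y =>
      (s + 2) * (|0 - y| ^ s * (0 - y)) * (1 - y ^ 2) ^ ((1 - s) / 2 - 1)
    have e : ∀ y : ℝ, (s + 2) * (|0 - -y| ^ s * (0 - -y)) * (1 - (-y) ^ 2) ^ ((1 - s) / 2 - 1) =
        -((s + 2) * (|0 - y| ^ s * (0 - y)) * (1 - y ^ 2) ^ ((1 - s) / 2 - 1)) := by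
      intro y
      simp
    simp only [e, integral_neg] at this
    simp only [hP']
    linarith
  have hPeven : ∀ x, P (-x) = P x := by
    intro x
    simp only [hP]
    rw [← setIntegral_Ioo_comp_neg]
    congr 1
    funext y
    rw [show -x - -y = -(x - y) by ring, abs_neg, neg_sq]
  have hP''eq : ∀ t, P'' t = (s + 2) * (s + 1) *
      ∫ y in Set.Ioo (-1 : ℝ) 1, |t - y| ^ s * (1 - y ^ 2) ^ ((1 - s) / 2 - 1) := by
    intro t
    rw [← integral_const_mul]
    simp only [hP'']
    congr 1
    funext y
    ring
  have hP0' : P 0 = ProbabilityTheory.beta ((s + 3) / 2) ((1 - s) / 2) := by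
    rw [← hP0]
    simp [hP]
  have q1 : ∀ t, HasDerivAt (fun t => (s + 2) * (s + 1) / 2 * B * t ^ 2)
      ((s + 2) * (s + 1) * B * t) t := by
    intro t
    refine ((hasDerivAt_pow 2 t).const_mul ((s + 2) * (s + 1) / 2 * B)).congr_deriv ?_
    push_cast
    ring
  have q2 : ∀ t, HasDerivAt (fun t => (s + 2) * (s + 1) * B * t) ((s + 2) * (s + 1) * B) t := by
    intro t
    simpa using (hasDerivAt_id t).const_mul ((s + 2) * (s + 1) * B)
  have key1 : ∀ x, 0 ≤ x → P 0 + (s + 2) * (s + 1) / 2 * B * x ^ 2 ≤ P x := by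
    intro x hx
    have := le_of_second_deriv_nonneg hx (fun t => (d1 t).sub (q1 t)) (fun t => (d2 t).sub (q2 t))
      (by simp [hP'0]) (fun t ht _ => by
        rw [hP''eq, ← mul_sub]
        exact mul_nonneg (by positivity) (sub_nonneg.2 (le_integral_abs_sub_rpow hs0 hs1 ht)))
    simp only [Pi.sub_apply] at this
    linarith
  have key2 : ∀ x, 0 ≤ x → x < 1 → P x ≤ P 0 + (s + 2) * (s + 1) / 2 * B * x ^ 2 := by
    intro x hx hx1
    have := le_of_second_deriv_nonneg hx (fun t => (q1 t).sub (d1 t)) (fun t => (q2 t).sub (d2 t))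
      (by simp [hP'0]) (fun t ht htx => by
        rw [hP''eq, integral_abs_sub_rpow_eq hs0 hs1 ⟨by linarith, by linarith⟩, ← hB, sub_self])
    simp only [Pi.sub_apply] at this
    linarith
  have habs : P |x| = P x := by
    rcases abs_choice x with h | h
    · rw [h]
    · rw [h, hPeven]
  rw [← hP0', ← sq_abs x]
  change P 0 + _ ≤ P x ∧ (_ → P x = _)
  rw [← habs]
  exact ⟨key1 _ (abs_nonneg x), fun h => le_antisymm (key2 _ (abs_nonneg x) h)
    (key1 _ (abs_nonneg x))⟩

theorem beta_one_half_pos {q : ℝ} (hq : 0 < q) : 0 < ProbabilityTheory.beta (1 / 2) q :=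
  ProbabilityTheory.beta_pos (by norm_num) hq

theorem beta_add_one_left {p q : ℝ} (hp : 0 < p) (hq : 0 < q) :
    ProbabilityTheory.beta (p + 1) q = p / (p + q) * ProbabilityTheory.beta p q := by
  unfold ProbabilityTheory.beta
  rw [show p + 1 + q = p + q + 1 by ring, Real.Gamma_add_one hp.ne',
    Real.Gamma_add_one (by positivity)]
  have := (Real.Gamma_pos_of_pos (add_pos hp hq)).ne'
  field_simp

/-- The translate by `a` of the equilibrium measure on `(-R, R)`. -/
noncomputable def equilibrium (α R C a : ℝ) : Measure ℝ :=
  volume.withDensity fun x => ENNReal.ofReal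
    (if |x - a| < R then C⁻¹ * R ^ (α - 2) * (R ^ 2 - (x - a) ^ 2) ^ (-(α - 1) / 2) else 0)

section equilibrium

variable {α R C a : ℝ}

theorem equilibriumDensity_nonneg (hR : 0 < R) (hC : 0 < C) (x : ℝ) :
    0 ≤ if |x - a| < R then C⁻¹ * R ^ (α - 2) * (R ^ 2 - (x - a) ^ 2) ^ (-(α - 1) / 2) else 0 := by
  split_ifs with h
  · have : 0 ≤ R ^ 2 - (x - a) ^ 2 := sub_nonneg.2 (sq_le_sq' (abs_lt.1 h).1.le (abs_lt.1 h).2.le)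
    positivity
  · exact le_rfl

theorem measurable_equilibriumDensity :
    Measurable fun x : ℝ =>
      if |x - a| < R then C⁻¹ * R ^ (α - 2) * (R ^ 2 - (x - a) ^ 2) ^ (-(α - 1) / 2) else 0 := by
  refine Measurable.ite (measurableSet_lt (by fun_prop) (by fun_prop)) ?_ (by fun_prop)
  fun_prop

theorem equilibriumDensity_affine (hR : 0 < R) (u : ℝ) :
    (if |a + R * u - a| < R then
      C⁻¹ * R ^ (α - 2) * (R ^ 2 - (a + R * u - a) ^ 2) ^ (-(α - 1) / 2) else 0) =
    R⁻¹ * C⁻¹ * (Set.Ioo (-1 : ℝ) 1).indicator (fun u => (1 - u ^ 2) ^ ((3 - α) / 2 - 1)) u := by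
  rw [add_sub_cancel_left, abs_mul, abs_of_pos hR]
  by_cases hu : u ∈ Set.Ioo (-1 : ℝ) 1
  · have h1 : |u| < 1 := abs_lt.2 hu
    have hU := mem_Ioo_neg_one_one_iff.1 hu
    rw [if_pos (by nlinarith), Set.indicator_of_mem hu, mul_pow,
      show R ^ 2 - R ^ 2 * u ^ 2 = R ^ 2 * (1 - u ^ 2) by ring, Real.mul_rpow (by positivity) hU.le,
      ← Real.rpow_natCast R 2, ← Real.rpow_mul hR.le,
      show -(α - 1) / 2 = (3 - α) / 2 - 1 by ring]
    have : R ^ (α - 2) * R ^ (((2 : ℕ) : ℝ) * ((3 - α) / 2 - 1)) = R⁻¹ := by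
      rw [← Real.rpow_add hR, ← Real.rpow_neg_one]
      congr 1
      push_cast
      ring
    rw [← this]
    ring
  · have h1 : ¬ |u| < 1 := fun h => hu (abs_lt.1 h)
    rw [if_neg (by nlinarith), Set.indicator_of_notMem hu, mul_zero]

theorem integral_equilibrium (hR : 0 < R) (hC : 0 < C) (f : ℝ → ℝ) :
    ∫ x, f x ∂(equilibrium α R C a) =
      C⁻¹ * ∫ u in Set.Ioo (-1 : ℝ) 1, f (a + R * u) * (1 - u ^ 2) ^ ((3 - α) / 2 - 1) := by
  unfold equilibrium
  rw [integral_withDensity_eq_integral_toReal_smul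
    measurable_equilibriumDensity.ennreal_ofReal
    (Filter.Eventually.of_forall fun _ => ENNReal.ofReal_lt_top)]
  simp only [ENNReal.toReal_ofReal (equilibriumDensity_nonneg hR hC _), smul_eq_mul]
  set g : ℝ → ℝ := fun x => (if |x - a| < R then
    C⁻¹ * R ^ (α - 2) * (R ^ 2 - (x - a) ^ 2) ^ (-(α - 1) / 2) else 0) * f x with hg
  have h1 : ∫ x, g x = R * ∫ u, g (a + R * u) := by
    rw [Measure.integral_comp_mul_left (fun x => g (a + x)), integral_add_left_eq_self g,
      abs_of_pos (inv_pos.2 hR), smul_eq_mul, mul_inv_cancel_left₀ hR.ne']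
  rw [h1, ← integral_const_mul, ← integral_indicator measurableSet_Ioo, ← integral_const_mul]
  congr 1
  funext u
  simp only [hg]
  rw [equilibriumDensity_affine hR]
  by_cases hu : u ∈ Set.Ioo (-1 : ℝ) 1
  · rw [Set.indicator_of_mem hu, Set.indicator_of_mem hu]
    field_simp
  · rw [Set.indicator_of_notMem hu, Set.indicator_of_notMem hu]
    ring

theorem integral_weight (hα3 : α < 3) :
    IntegrableOn (fun u : ℝ => (1 - u ^ 2) ^ ((3 - α) / 2 - 1)) (Set.Ioo (-1) 1) ∧
    ∫ u in Set.Ioo (-1 : ℝ) 1, (1 - u ^ 2) ^ ((3 - α) / 2 - 1) =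
      ProbabilityTheory.beta (1 / 2) ((3 - α) / 2) := by
  simpa using integral_abs_rpow_mul_one_sub_sq_rpow (p := 0) (q := (3 - α) / 2)
    (by norm_num) (by linarith)

theorem isProbabilityMeasure_equilibrium (hα3 : α < 3) (hR : 0 < R)
    (hC : C = ProbabilityTheory.beta (1 / 2) ((3 - α) / 2)) :
    IsProbabilityMeasure (equilibrium α R C a) := by
  have hC0 : 0 < C := hC ▸ beta_one_half_pos (by linarith)
  have hint : Integrable fun x : ℝ =>
      if |x - a| < R then C⁻¹ * R ^ (α - 2) * (R ^ 2 - (x - a) ^ 2) ^ (-(α - 1) / 2) else 0 := by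
    set g : ℝ → ℝ := fun x =>
      if |x - a| < R then C⁻¹ * R ^ (α - 2) * (R ^ 2 - (x - a) ^ 2) ^ (-(α - 1) / 2) else 0
      with hg
    have h1 : Integrable fun u => g (a + R * u) := by
      have h := ((integral_weight hα3).1.integrable_indicator measurableSet_Ioo).const_mul
        (R⁻¹ * C⁻¹)
      refine h.congr (Filter.Eventually.of_forall fun u => ?_)
      exact (equilibriumDensity_affine hR u).symm
    have h2 : Integrable fun x => g (a + x) :=
      (integrable_comp_mul_left_iff (fun x => g (a + x)) hR.ne').1 h1
    have h3 := h2.comp_add_left (-a)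
    simpa using h3
  have hfin : IsFiniteMeasure (equilibrium α R C a) := by
    unfold equilibrium
    exact isFiniteMeasure_withDensity_ofReal hint.2
  have h1 := integral_equilibrium (α := α) (a := a) hR hC0 (fun _ => 1)
  simp only [one_mul, (integral_weight hα3).2, ← hC, inv_mul_cancel₀ hC0.ne', integral_const,
    smul_eq_mul, mul_one] at h1
  refine ⟨?_⟩
  rw [← ENNReal.toReal_eq_one_iff]
  exact h1

theorem ae_equilibrium : ∀ᵐ x ∂(equilibrium α R C a), |x - a| < R := by
  unfold equilibrium
  rw [ae_withDensity_iff measurable_equilibriumDensity.ennreal_ofReal]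
  refine Filter.Eventually.of_forall fun x hx => ?_
  by_contra h
  simp [h] at hx

theorem integrable_equilibrium [IsFiniteMeasure (equilibrium α R C a)] {f : ℝ → ℝ}
    (hf : Continuous f) : Integrable f (equilibrium α R C a) := by
  obtain ⟨M, hM⟩ := (isCompact_Icc (a := a - R) (b := a + R)).exists_bound_of_continuousOn
    hf.continuousOn
  refine Integrable.of_bound hf.aestronglyMeasurable M ?_
  filter_upwards [ae_equilibrium] with x hx
  rw [abs_lt] at hx
  exact hM x ⟨by linarith [hx.1], by linarith [hx.2]⟩

theorem integral_mul_weight_eq_zero :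
    ∫ u in Set.Ioo (-1 : ℝ) 1, u * (1 - u ^ 2) ^ ((3 - α) / 2 - 1) = 0 := by
  have := setIntegral_Ioo_comp_neg fun u => u * (1 - u ^ 2) ^ ((3 - α) / 2 - 1)
  simp only [neg_sq, neg_mul, integral_neg] at this
  linarith

theorem integrableOn_continuous_mul_weight (hα3 : α < 3) {f : ℝ → ℝ} (hf : Continuous f) :
    IntegrableOn (fun u : ℝ => f u * (1 - u ^ 2) ^ ((3 - α) / 2 - 1)) (Set.Ioo (-1) 1) := by
  have := integrableOn_comp_sub_mul (integral_weight hα3).1 (hf.comp continuous_neg) 0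
  simpa using this

theorem integrableOn_mul_weight (hα3 : α < 3) :
    IntegrableOn (fun u : ℝ => u * (1 - u ^ 2) ^ ((3 - α) / 2 - 1)) (Set.Ioo (-1) 1) :=
  integrableOn_continuous_mul_weight hα3 continuous_id

theorem integral_id_equilibrium (hα3 : α < 3) (hR : 0 < R)
    (hC : C = ProbabilityTheory.beta (1 / 2) ((3 - α) / 2)) :
    ∫ x, x ∂(equilibrium α R C a) = a := by
  have hC0 : 0 < C := hC ▸ beta_one_half_pos (by linarith)
  rw [integral_equilibrium hR hC0]
  have e : ∀ u : ℝ, (a + R * u) * (1 - u ^ 2) ^ ((3 - α) / 2 - 1) =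
      a * (1 - u ^ 2) ^ ((3 - α) / 2 - 1) + R * (u * (1 - u ^ 2) ^ ((3 - α) / 2 - 1)) := by
    intro u
    ring
  simp only [e]
  rw [integral_add ((integral_weight hα3).1.const_mul a)
    ((integrableOn_mul_weight hα3).const_mul R), integral_const_mul,
    integral_const_mul, integral_mul_weight_eq_zero, (integral_weight hα3).2, ← hC]
  field_simp
  ring

theorem integral_sub_sq_equilibrium (hα3 : α < 3) (hR : 0 < R)
    (hC : C = ProbabilityTheory.beta (1 / 2) ((3 - α) / 2)) (x : ℝ) :
    ∫ y, |x - y| ^ 2 ∂(equilibrium α R C a) = (x - a) ^ 2 + R ^ 2 / (4 - α) := by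
  have hC0 : 0 < C := hC ▸ beta_one_half_pos (by linarith)
  have h2 : ∫ u in Set.Ioo (-1 : ℝ) 1, u ^ 2 * (1 - u ^ 2) ^ ((3 - α) / 2 - 1) =
      C / (4 - α) := by
    have := (integral_abs_rpow_mul_one_sub_sq_rpow (p := 2) (q := (3 - α) / 2)
      (by norm_num) (by linarith)).2
    simp only [Real.rpow_two, sq_abs] at this
    rw [this, show ((2 : ℝ) + 1) / 2 = 1 / 2 + 1 by norm_num,
      beta_add_one_left (by norm_num) (by linarith), ← hC]
    have h4 : 4 - α ≠ 0 := by linarith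
    have h5 : 1 / 2 + (3 - α) / 2 = (4 - α) / 2 := by ring
    rw [h5]
    field_simp
  rw [integral_equilibrium hR hC0]
  have e : ∀ u : ℝ, |x - (a + R * u)| ^ 2 * (1 - u ^ 2) ^ ((3 - α) / 2 - 1) =
      (x - a) ^ 2 * (1 - u ^ 2) ^ ((3 - α) / 2 - 1) +
      (R ^ 2 * (u ^ 2 * (1 - u ^ 2) ^ ((3 - α) / 2 - 1)) -
        2 * R * (x - a) * (u * (1 - u ^ 2) ^ ((3 - α) / 2 - 1))) := by
    intro u
    rw [sq_abs]
    ring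
  have i1 := (integrableOn_continuous_mul_weight hα3 (continuous_pow 2)).const_mul (R ^ 2)
  have i2 := (integrableOn_mul_weight hα3).const_mul (2 * R * (x - a))
  have i3 := i1.sub i2
  simp only [Pi.sub_def] at i3
  simp only [e]
  rw [integral_add ((integral_weight hα3).1.const_mul _) i3, integral_sub i1 i2]
  simp only [integral_const_mul]
  have h0 := integral_mul_weight_eq_zero (α := α)
  rw [h0, (integral_weight hα3).2, ← hC, h2]
  have h4 : 4 - α ≠ 0 := by linarith
  field_simp
  ring

theorem integral_abs_sub_rpow_equilibrium (hα2 : 2 < α) (hα3 : α < 3) (hR : 0 < R)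
    (hC : C = ProbabilityTheory.beta (1 / 2) ((3 - α) / 2))
    (hRC : R ^ (α - 2) * ((α - 1) * ProbabilityTheory.beta ((α - 1) / 2) ((3 - α) / 2)) = C)
    (x : ℝ) :
    (R ^ 2 / 2 + α / 2 * (x - a) ^ 2 ≤ ∫ y, |x - y| ^ α ∂(equilibrium α R C a)) ∧
    (|x - a| < R →
      ∫ y, |x - y| ^ α ∂(equilibrium α R C a) = R ^ 2 / 2 + α / 2 * (x - a) ^ 2) := by
  have hC0 : 0 < C := hC ▸ beta_one_half_pos (by linarith)
  have key := integral_abs_sub_rpow_add_two (s := α - 2) (by linarith) (by linarith) ((x - a) / R)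
  rw [show α - 2 + 2 = α by ring, show (1 - (α - 2)) / 2 = (3 - α) / 2 by ring,
    show (α - 2 + 3) / 2 = (α - 1) / 2 + 1 by ring, show α - 2 + 1 = α - 1 by ring,
    beta_add_one_left (by linarith) (by linarith),
    show (α - 1) / 2 + (3 - α) / 2 = 1 by ring, div_one] at key
  set B := ProbabilityTheory.beta ((α - 1) / 2) ((3 - α) / 2)
  set P := ∫ y in Set.Ioo (-1 : ℝ) 1, |(x - a) / R - y| ^ α * (1 - y ^ 2) ^ ((3 - α) / 2 - 1)
  have hRα : R ^ α = R ^ (α - 2) * R ^ 2 := by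
    rw [← Real.rpow_natCast R 2, ← Real.rpow_add hR]
    congr 1
    push_cast
    ring
  have hint : ∫ y, |x - y| ^ α ∂(equilibrium α R C a) = C⁻¹ * R ^ α * P := by
    rw [integral_equilibrium hR hC0, mul_assoc]
    simp only [P]
    rw [← integral_const_mul (R ^ α)]
    congr 2
    funext u
    rw [← mul_assoc, ← Real.mul_rpow hR.le (abs_nonneg _)]
    nth_rewrite 2 [← abs_of_pos hR]
    rw [← abs_mul]
    congr 3
    field_simp
    ring
  have hval : C⁻¹ * R ^ α * ((α - 1) / 2 * B + α * (α - 1) / 2 * B * ((x - a) / R) ^ 2) =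
      R ^ 2 / 2 + α / 2 * (x - a) ^ 2 := by
    rw [hRα, ← hRC]
    have hp : R ^ (α - 2) ≠ 0 := (Real.rpow_pos_of_pos hR _).ne'
    have hB : B ≠ 0 := (ProbabilityTheory.beta_pos (by linarith) (by linarith)).ne'
    have h1 : α - 1 ≠ 0 := by linarith
    field_simp
  have hpos : 0 ≤ C⁻¹ * R ^ α := by positivity
  rw [hint, ← hval]
  refine ⟨mul_le_mul_of_nonneg_left key.1 hpos, fun h => ?_⟩
  rw [key.2]
  rwa [abs_div, abs_of_pos hR, div_lt_one hR]

theorem integral_kernel_equilibrium (hα2 : 2 < α) (hα3 : α < 3) (hR : 0 < R)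
    (hC : C = ProbabilityTheory.beta (1 / 2) ((3 - α) / 2))
    (hRC : R ^ (α - 2) * ((α - 1) * ProbabilityTheory.beta ((α - 1) / 2) ((3 - α) / 2)) = C)
    (x : ℝ) :
    (-((α - 2) / (α * (4 - α))) * R ^ 2 ≤
      ∫ y, (α⁻¹ * |x - y| ^ α - 2⁻¹ * |x - y| ^ 2) ∂(equilibrium α R C a)) ∧
    (|x - a| < R → ∫ y, (α⁻¹ * |x - y| ^ α - 2⁻¹ * |x - y| ^ 2) ∂(equilibrium α R C a) =
      -((α - 2) / (α * (4 - α))) * R ^ 2) := by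
  have := isProbabilityMeasure_equilibrium (a := a) hα3 hR hC
  have key := integral_abs_sub_rpow_equilibrium (a := a) hα2 hα3 hR hC hRC x
  have i1 : Integrable (fun y => |x - y| ^ α) (equilibrium α R C a) :=
    integrable_equilibrium ((continuous_abs_rpow (by linarith)).comp
      (continuous_const.sub continuous_id))
  have i2 : Integrable (fun y => |x - y| ^ 2) (equilibrium α R C a) :=
    integrable_equilibrium (by fun_prop)
  rw [integral_sub (i1.const_mul _) (i2.const_mul _), integral_const_mul, integral_const_mul,
    integral_sub_sq_equilibrium hα3 hR hC]
  have h4 : 4 - α ≠ 0 := by linarith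
  have h0 : 0 < α := by linarith
  have e : -((α - 2) / (α * (4 - α))) * R ^ 2 =
      α⁻¹ * (R ^ 2 / 2 + α / 2 * (x - a) ^ 2) - 2⁻¹ * ((x - a) ^ 2 + R ^ 2 / (4 - α)) := by
    field_simp
    ring
  rw [e]
  refine ⟨?_, fun h => by rw [key.2 h]⟩
  have := mul_le_mul_of_nonneg_left key.1 (inv_nonneg.2 h0.le)
  linarith

end equilibrium

/-- The second-order Taylor remainder of the cosine at `0`. -/
noncomputable def cosTail (u : ℝ) : ℝ := Real.cos u - 1 + u ^ 2 / 2

theorem continuous_cosTail : Continuous cosTail := by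
  unfold cosTail
  fun_prop

theorem cosTail_nonneg (u : ℝ) : 0 ≤ cosTail u := by
  have := Real.one_sub_sq_div_two_le_cos (x := u)
  unfold cosTail
  linarith

theorem cosTail_pos {u : ℝ} (hu : u ≠ 0) : 0 < cosTail u := by
  have := Real.one_sub_sq_div_two_lt_cos hu
  unfold cosTail
  linarith

theorem cosTail_le_sq (u : ℝ) : cosTail u ≤ u ^ 2 / 2 := by
  have := Real.cos_le_one u
  unfold cosTail
  linarith

theorem cosTail_le_pow_four {u : ℝ} (hu : |u| ≤ 1) : cosTail u ≤ u ^ 4 := by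
  have h := (abs_le.1 (Real.cos_bound hu)).2
  have h4 : |u| ^ 4 = u ^ 4 := by
    rw [show 4 = 2 * 2 by norm_num, pow_mul, sq_abs, ← pow_mul]
  rw [h4] at h
  have : 0 ≤ u ^ 4 := by positivity
  unfold cosTail
  linarith

theorem cosTail_mul_abs (t z : ℝ) : cosTail (t * |z|) = cosTail (t * z) := by
  rcases abs_choice z with h | h <;> simp [cosTail, h]

theorem integrableOn_cosTail {α : ℝ} (hα2 : 2 < α) (hα4 : α < 4) :
    IntegrableOn (fun t => cosTail t * t ^ (-1 - α)) (Set.Ioi 0) := by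
  have hm : Measurable fun t : ℝ => cosTail t * t ^ (-1 - α) :=
    continuous_cosTail.measurable.mul (by fun_prop)
  rw [← Set.Ioo_union_Ici_eq_Ioi one_pos, integrableOn_union]
  constructor
  · refine Integrable.mono' ((intervalIntegral.integrableOn_Ioo_rpow_iff (s := 3 - α) one_pos).2
      (by linarith)) hm.aestronglyMeasurable ?_
    filter_upwards [ae_restrict_mem measurableSet_Ioo] with t ht
    have hp := Real.rpow_pos_of_pos ht.1 (-1 - α)
    rw [Real.norm_of_nonneg (mul_nonneg (cosTail_nonneg _) hp.le),
      show 3 - α = ((4 : ℕ) : ℝ) + (-1 - α) by push_cast; ring, Real.rpow_add ht.1,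
      Real.rpow_natCast]
    exact mul_le_mul_of_nonneg_right
      (cosTail_le_pow_four (by rw [abs_of_pos ht.1]; exact ht.2.le)) hp.le
  · rw [integrableOn_Ici_iff_integrableOn_Ioi]
    refine Integrable.mono' (integrableOn_Ioi_rpow_of_lt (a := 1 - α) (by linarith) one_pos)
      hm.aestronglyMeasurable ?_
    filter_upwards [ae_restrict_mem measurableSet_Ioi] with t ht
    have ht0 : 0 < t := one_pos.trans ht
    have hp := Real.rpow_pos_of_pos ht0 (-1 - α)
    rw [Real.norm_of_nonneg (mul_nonneg (cosTail_nonneg _) hp.le),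
      show 1 - α = ((2 : ℕ) : ℝ) + (-1 - α) by push_cast; ring, Real.rpow_add ht0,
      Real.rpow_natCast]
    have := cosTail_le_sq t
    exact mul_le_mul_of_nonneg_right (by nlinarith [sq_nonneg t]) hp.le

theorem integral_cosTail_pos {α : ℝ} (hα2 : 2 < α) (hα4 : α < 4) :
    0 < ∫ t in Set.Ioi 0, cosTail t * t ^ (-1 - α) := by
  rw [setIntegral_pos_iff_support_of_nonneg_ae _ (integrableOn_cosTail hα2 hα4)]
  · have : Function.support (fun t : ℝ => cosTail t * t ^ (-1 - α)) ∩ Set.Ioi 0 = Set.Ioi 0 := by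
      refine Set.inter_eq_right.2 fun t ht => ?_
      exact (mul_pos (cosTail_pos (ne_of_gt ht)) (Real.rpow_pos_of_pos ht _)).ne'
    rw [this]
    simp
  · filter_upwards [ae_restrict_mem measurableSet_Ioi] with t ht
    exact mul_nonneg (cosTail_nonneg _) (Real.rpow_pos_of_pos ht _).le

theorem integral_cosTail_mul {α : ℝ} (hα2 : 2 < α) (hα4 : α < 4) (z : ℝ) :
    IntegrableOn (fun t => cosTail (t * z) * t ^ (-1 - α)) (Set.Ioi 0) ∧
    ∫ t in Set.Ioi 0, cosTail (t * z) * t ^ (-1 - α) =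
      (∫ t in Set.Ioi 0, cosTail t * t ^ (-1 - α)) * |z| ^ α := by
  rcases eq_or_ne z 0 with rfl | hz
  · simp [cosTail, Real.zero_rpow (by linarith : α ≠ 0)]
  have hz0 : 0 < |z| := abs_pos.2 hz
  have e : Set.EqOn (fun t => |z| ^ (1 + α) * (cosTail (t * |z|) * (t * |z|) ^ (-1 - α)))
      (fun t => cosTail (t * z) * t ^ (-1 - α)) (Set.Ioi 0) := by
    intro t ht
    simp only
    rw [cosTail_mul_abs, Real.mul_rpow (le_of_lt ht) hz0.le]
    have : |z| ^ (1 + α) * |z| ^ (-1 - α) = 1 := by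
      rw [← Real.rpow_add hz0]
      ring_nf
      exact Real.rpow_zero _
    linear_combination cosTail (t * z) * t ^ (-1 - α) * this
  constructor
  · refine IntegrableOn.congr_fun (Integrable.const_mul ?_ _) e measurableSet_Ioi
    refine (integrableOn_Ioi_comp_mul_right_iff (fun t => cosTail t * t ^ (-1 - α)) 0 hz0).2 ?_
    rw [zero_mul]
    exact integrableOn_cosTail hα2 hα4
  · rw [← setIntegral_congr_fun measurableSet_Ioi e, integral_const_mul,
      integral_comp_mul_right_Ioi (fun t => cosTail t * t ^ (-1 - α)) 0 hz0, zero_mul, smul_eq_mul,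
      Real.rpow_add hz0, Real.rpow_one]
    field_simp

theorem integral_integral_cosTail {X : Type*} [MeasurableSpace X] {ρ : Measure X} [SFinite ρ]
    {α : ℝ} (hα2 : 2 < α) (hα4 : α < 4) {z : X → ℝ} (hz : Measurable z)
    (hint : Integrable (fun x => |z x| ^ α) ρ) :
    IntegrableOn (fun t => (∫ x, cosTail (t * z x) ∂ρ) * t ^ (-1 - α)) (Set.Ioi 0) ∧
    ∫ t in Set.Ioi 0, (∫ x, cosTail (t * z x) ∂ρ) * t ^ (-1 - α) =
      (∫ t in Set.Ioi 0, cosTail t * t ^ (-1 - α)) * ∫ x, |z x| ^ α ∂ρ := by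
  set H : X → ℝ → ℝ := fun x t => cosTail (t * z x) * t ^ (-1 - α) with hH
  have hm : Measurable (Function.uncurry H) := by
    refine Measurable.mul (continuous_cosTail.measurable.comp ?_) ?_
    · exact measurable_snd.mul (hz.comp measurable_fst)
    · exact measurable_snd.pow_const _
  have hI : Integrable (Function.uncurry H) (ρ.prod (volume.restrict (Set.Ioi 0))) := by
    rw [integrable_prod_iff hm.aestronglyMeasurable]
    refine ⟨Filter.Eventually.of_forall fun x => (integral_cosTail_mul hα2 hα4 (z x)).1, ?_⟩
    refine (hint.const_mul (∫ t in Set.Ioi 0, cosTail t * t ^ (-1 - α))).congr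
      (Filter.Eventually.of_forall fun x => ?_)
    simp only
    rw [← (integral_cosTail_mul hα2 hα4 (z x)).2]
    refine setIntegral_congr_fun measurableSet_Ioi fun t ht => ?_
    exact (Real.norm_of_nonneg
      (mul_nonneg (cosTail_nonneg _) (Real.rpow_pos_of_pos ht _).le)).symm
  have h1 := hI.integral_prod_right
  have h2 := integral_integral_swap hI
  simp only [hH, Function.uncurry, integral_mul_const, (integral_cosTail_mul hα2 hα4 _).2,
    integral_const_mul] at h1 h2
  exact ⟨h1, h2.symm⟩

theorem memLp_id_of_integrable_abs_rpow {μ : Measure ℝ} {α : ℝ} (hα : 0 < α)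
    (h : Integrable (fun x => |x| ^ α) μ) :
    MemLp (fun x => x) (ENNReal.ofReal α) μ := by
  rw [← integrable_norm_rpow_iff (by fun_prop) (by simpa using hα) ENNReal.ofReal_ne_top,
    ENNReal.toReal_ofReal hα.le]
  exact h

section moments

variable {μ ν : Measure ℝ} [IsProbabilityMeasure μ] [IsProbabilityMeasure ν] {α : ℝ}

theorem integrable_of_integrable_abs_rpow (hα : 1 ≤ α) (h : Integrable (fun x => |x| ^ α) μ) :
    Integrable (fun x => x) μ :=
  memLp_one_iff_integrable.1 <|
    (memLp_id_of_integrable_abs_rpow (one_pos.trans_le hα) h).mono_exponent (by simpa using hα)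

theorem integrable_sq_of_integrable_abs_rpow (hα : 2 ≤ α) (h : Integrable (fun x => |x| ^ α) μ) :
    Integrable (fun x => x ^ 2) μ :=
  MemLp.integrable_sq <|
    (memLp_id_of_integrable_abs_rpow (two_pos.trans_le hα) h).mono_exponent (by simpa using hα)

theorem integrable_abs_sub_rpow (hα : 0 < α) (hμ : Integrable (fun x => |x| ^ α) μ)
    (hν : Integrable (fun x => |x| ^ α) ν) :
    Integrable (fun p : ℝ × ℝ => |p.1 - p.2| ^ α) (μ.prod ν) := by
  have h := ((memLp_id_of_integrable_abs_rpow hα hμ).comp_fst ν).sub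
    ((memLp_id_of_integrable_abs_rpow hα hν).comp_snd μ)
  have := h.integrable_norm_rpow (by simpa using hα) ENNReal.ofReal_ne_top
  rw [ENNReal.toReal_ofReal hα.le] at this
  exact this

theorem integrable_abs_rpow_of_prod (hα : 0 < α)
    (h : Integrable (fun p : ℝ × ℝ => |p.1 - p.2| ^ α) (μ.prod ν)) :
    Integrable (fun x => |x| ^ α) ν := by
  obtain ⟨x, hx⟩ := h.prod_right_ae.exists
  have h1 : MemLp (fun y => x - y) (ENNReal.ofReal α) ν := by
    rw [← integrable_norm_rpow_iff (by fun_prop) (by simpa using hα) ENNReal.ofReal_ne_top,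
      ENNReal.toReal_ofReal hα.le]
    exact hx
  have h2 := ((memLp_const x).sub h1).integrable_norm_rpow (by simpa using hα)
    ENNReal.ofReal_ne_top
  rw [ENNReal.toReal_ofReal hα.le] at h2
  simpa using h2

theorem integral_sub_sq_prod (hμ1 : Integrable (fun x => x) μ) (hν1 : Integrable (fun x => x) ν)
    (hμ2 : Integrable (fun x => x ^ 2) μ) (hν2 : Integrable (fun x => x ^ 2) ν) :
    Integrable (fun p : ℝ × ℝ => (p.1 - p.2) ^ 2) (μ.prod ν) ∧
    ∫ p, (p.1 - p.2) ^ 2 ∂(μ.prod ν) =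
      ∫ x, x ^ 2 ∂μ + ∫ x, x ^ 2 ∂ν - 2 * ((∫ x, x ∂μ) * ∫ x, x ∂ν) := by
  have i1 := hμ2.comp_fst ν
  have i2 := hν2.comp_snd μ
  have i3 := (hμ1.mul_prod hν1).const_mul 2
  have e : (fun p : ℝ × ℝ => (p.1 - p.2) ^ 2) = fun p => p.1 ^ 2 + p.2 ^ 2 - 2 * (p.1 * p.2) := by
    funext p
    ring
  rw [e]
  have i12 : Integrable (fun p : ℝ × ℝ => p.1 ^ 2 + p.2 ^ 2) (μ.prod ν) := i1.add i2
  refine ⟨i12.sub i3, ?_⟩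
  rw [integral_sub i12 i3, integral_add i1 i2, integral_const_mul,
    integral_prod_mul (fun x => x) (fun x => x),
    integral_fun_fst (fun x : ℝ => x ^ 2), integral_fun_snd (fun x : ℝ => x ^ 2)]
  simp

theorem integrable_cos_mul (t : ℝ) : Integrable (fun x => Real.cos (t * x)) μ :=
  Integrable.of_bound (by fun_prop) 1 (Filter.Eventually.of_forall fun x => Real.abs_cos_le_one _)

theorem integrable_sin_mul (t : ℝ) : Integrable (fun x => Real.sin (t * x)) μ :=
  Integrable.of_bound (by fun_prop) 1 (Filter.Eventually.of_forall fun x => Real.abs_sin_le_one _)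

theorem integral_cosTail_prod
    (h : Integrable (fun p : ℝ × ℝ => (p.1 - p.2) ^ 2) (μ.prod ν)) (t : ℝ) :
    ∫ p, cosTail (t * (p.1 - p.2)) ∂(μ.prod ν) =
      (∫ x, Real.cos (t * x) ∂μ) * (∫ x, Real.cos (t * x) ∂ν) +
      (∫ x, Real.sin (t * x) ∂μ) * (∫ x, Real.sin (t * x) ∂ν) - 1 +
      t ^ 2 / 2 * ∫ p, (p.1 - p.2) ^ 2 ∂(μ.prod ν) := by
  have i1 := (integrable_cos_mul (μ := μ) t).mul_prod (integrable_cos_mul (μ := ν) t)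
  have i2 := (integrable_sin_mul (μ := μ) t).mul_prod (integrable_sin_mul (μ := ν) t)
  have i12 : Integrable (fun p : ℝ × ℝ => Real.cos (t * p.1) * Real.cos (t * p.2) +
    Real.sin (t * p.1) * Real.sin (t * p.2)) (μ.prod ν) := i1.add i2
  have i3 : Integrable (fun p : ℝ × ℝ => Real.cos (t * p.1) * Real.cos (t * p.2) +
    Real.sin (t * p.1) * Real.sin (t * p.2) - 1) (μ.prod ν) := i12.sub (integrable_const 1)
  have e : ∀ p : ℝ × ℝ, cosTail (t * (p.1 - p.2)) =
      Real.cos (t * p.1) * Real.cos (t * p.2) + Real.sin (t * p.1) * Real.sin (t * p.2) - 1 +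
        t ^ 2 / 2 * (p.1 - p.2) ^ 2 := by
    intro p
    unfold cosTail
    rw [mul_sub, Real.cos_sub]
    ring
  simp only [e]
  rw [integral_add i3 (h.const_mul _), integral_sub i12 (integrable_const 1), integral_add i1 i2,
    integral_prod_mul (fun x => Real.cos (t * x)) (fun x => Real.cos (t * x)),
    integral_prod_mul (fun x => Real.sin (t * x)) (fun x => Real.sin (t * x)), integral_const_mul]
  simp

theorem continuous_integral_cos_mul : Continuous fun t => ∫ x, Real.cos (t * x) ∂μ :=
  continuous_of_dominated (bound := fun _ => 1) (fun t => by fun_prop)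
    (fun t => Filter.Eventually.of_forall fun x => Real.abs_cos_le_one _) (integrable_const 1)
    (Filter.Eventually.of_forall fun x => by fun_prop)

theorem continuous_integral_sin_mul : Continuous fun t => ∫ x, Real.sin (t * x) ∂μ :=
  continuous_of_dominated (bound := fun _ => 1) (fun t => by fun_prop)
    (fun t => Filter.Eventually.of_forall fun x => Real.abs_sin_le_one _) (integrable_const 1)
    (Filter.Eventually.of_forall fun x => by fun_prop)

theorem charFun_eq_integral_cos_add_integral_sin (t : ℝ) :
    charFun μ t = ((∫ x, Real.cos (t * x) ∂μ : ℝ) : ℂ) +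
      ((∫ x, Real.sin (t * x) ∂μ : ℝ) : ℂ) * Complex.I := by
  rw [charFun_apply_real, ← integral_complex_ofReal, ← integral_complex_ofReal,
    ← integral_mul_const, ← integral_add (integrable_cos_mul t).ofReal
      ((integrable_sin_mul t).ofReal.mul_const _)]
  congr 1
  funext x
  rw [← Complex.ofReal_mul, Complex.exp_mul_I, Complex.ofReal_cos, Complex.ofReal_sin]

theorem eq_of_integral_cos_sin_eq
    (hc : ∀ t : ℝ, 0 < t → ∫ x, Real.cos (t * x) ∂μ = ∫ x, Real.cos (t * x) ∂ν)
    (hs : ∀ t : ℝ, 0 < t → ∫ x, Real.sin (t * x) ∂μ = ∫ x, Real.sin (t * x) ∂ν) : μ = ν := by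
  refine Measure.ext_of_charFun (funext fun t => ?_)
  rw [charFun_eq_integral_cos_add_integral_sin, charFun_eq_integral_cos_add_integral_sin]
  rcases lt_trichotomy t 0 with ht | rfl | ht
  · have hc' := hc (-t) (neg_pos.2 ht)
    have hs' := hs (-t) (neg_pos.2 ht)
    simp only [neg_mul, Real.cos_neg, Real.sin_neg, integral_neg, neg_inj] at hc' hs'
    rw [hc', hs']
  · simp
  · rw [hc t ht, hs t ht]

/-- For `2 < α < 4`, the kernel `|x - y| ^ α` is strictly positive definite on differences of
probability measures having the same mean. -/
theorem abs_sub_rpow_positive_definite (hα2 : 2 < α) (hα4 : α < 4)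
    (hμ : Integrable (fun x => |x| ^ α) μ) (hν : Integrable (fun x => |x| ^ α) ν)
    (hmean : ∫ x, x ∂μ = ∫ x, x ∂ν) :
    0 ≤ ∫ p, |p.1 - p.2| ^ α ∂(μ.prod μ) - 2 * ∫ p, |p.1 - p.2| ^ α ∂(μ.prod ν) +
      ∫ p, |p.1 - p.2| ^ α ∂(ν.prod ν) ∧
    (∫ p, |p.1 - p.2| ^ α ∂(μ.prod μ) - 2 * ∫ p, |p.1 - p.2| ^ α ∂(μ.prod ν) +
      ∫ p, |p.1 - p.2| ^ α ∂(ν.prod ν) = 0 → μ = ν) := by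
  have hα0 : 0 < α := by linarith
  have hμ1 := integrable_of_integrable_abs_rpow (by linarith) hμ
  have hν1 := integrable_of_integrable_abs_rpow (by linarith) hν
  have hμ2 := integrable_sq_of_integrable_abs_rpow hα2.le hμ
  have hν2 := integrable_sq_of_integrable_abs_rpow hα2.le hν
  have hz : Measurable fun p : ℝ × ℝ => p.1 - p.2 := measurable_fst.sub measurable_snd
  obtain ⟨j1, k1⟩ := integral_integral_cosTail hα2 hα4 hz (integrable_abs_sub_rpow hα0 hμ hμ)
  obtain ⟨j2, k2⟩ := integral_integral_cosTail hα2 hα4 hz (integrable_abs_sub_rpow hα0 hμ hν)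
  obtain ⟨j3, k3⟩ := integral_integral_cosTail hα2 hα4 hz (integrable_abs_sub_rpow hα0 hν hν)
  set κ := ∫ t in Set.Ioi 0, cosTail t * t ^ (-1 - α)
  have hκ : 0 < κ := integral_cosTail_pos hα2 hα4
  set Q := ∫ p, |p.1 - p.2| ^ α ∂(μ.prod μ) - 2 * ∫ p, |p.1 - p.2| ^ α ∂(μ.prod ν) +
      ∫ p, |p.1 - p.2| ^ α ∂(ν.prod ν) with hQ
  set P : ℝ → ℝ := fun t => (∫ x, Real.cos (t * x) ∂μ - ∫ x, Real.cos (t * x) ∂ν) ^ 2 +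
    (∫ x, Real.sin (t * x) ∂μ - ∫ x, Real.sin (t * x) ∂ν) ^ 2 with hP
  have hcomb : ∀ t, (∫ p, cosTail (t * (p.1 - p.2)) ∂(μ.prod μ)) * t ^ (-1 - α) -
      2 * ((∫ p, cosTail (t * (p.1 - p.2)) ∂(μ.prod ν)) * t ^ (-1 - α)) +
      (∫ p, cosTail (t * (p.1 - p.2)) ∂(ν.prod ν)) * t ^ (-1 - α) = P t * t ^ (-1 - α) := by
    intro t
    obtain ⟨q1, r1⟩ := integral_sub_sq_prod hμ1 hμ1 hμ2 hμ2
    obtain ⟨q2, r2⟩ := integral_sub_sq_prod hμ1 hν1 hμ2 hν2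
    obtain ⟨q3, r3⟩ := integral_sub_sq_prod hν1 hν1 hν2 hν2
    rw [integral_cosTail_prod q1, integral_cosTail_prod q2, integral_cosTail_prod q3, r1, r2, r3,
      hmean]
    simp only [hP]
    ring
  have hi : IntegrableOn (fun t => P t * t ^ (-1 - α)) (Set.Ioi 0) :=
    ((j1.sub (j2.const_mul 2)).add j3).congr (Filter.Eventually.of_forall hcomb)
  have hval : ∫ t in Set.Ioi 0, P t * t ^ (-1 - α) = κ * Q := by
    have := integral_add (j1.sub (j2.const_mul 2)) j3
    simp only [Pi.sub_apply, hcomb] at this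
    rw [this, integral_sub j1 (j2.const_mul 2), integral_const_mul, k1, k2, k3, hQ]
    ring
  have hP0 : ∀ t, 0 ≤ P t := fun t => by positivity
  have hn : 0 ≤ᵐ[volume.restrict (Set.Ioi 0)] fun t => P t * t ^ (-1 - α) := by
    filter_upwards [ae_restrict_mem measurableSet_Ioi] with t ht
    exact mul_nonneg (hP0 t) (Real.rpow_pos_of_pos ht _).le
  refine ⟨?_, fun h0 => ?_⟩
  · have := integral_nonneg_of_ae hn
    rw [hval] at this
    exact nonneg_of_mul_nonneg_right this hκ
  · rw [h0, mul_zero, setIntegral_eq_zero_iff_of_nonneg_ae hn hi] at hval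
    have hPae : P =ᵐ[volume.restrict (Set.Ioi 0)] fun _ => 0 := by
      filter_upwards [hval, ae_restrict_mem measurableSet_Ioi] with t h ht
      exact (mul_eq_zero.1 h).resolve_right (Real.rpow_pos_of_pos ht _).ne'
    have hPc : Continuous P :=
      ((continuous_integral_cos_mul.sub continuous_integral_cos_mul).pow 2).add
        ((continuous_integral_sin_mul.sub continuous_integral_sin_mul).pow 2)
    have hPz := Measure.eqOn_open_of_ae_eq hPae isOpen_Ioi hPc.continuousOn continuousOn_const
    refine eq_of_integral_cos_sin_eq (fun t ht => ?_) (fun t ht => ?_)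
    · have : P t = 0 := hPz ht
      simp only [hP] at this
      nlinarith [sq_nonneg (∫ x, Real.sin (t * x) ∂μ - ∫ x, Real.sin (t * x) ∂ν),
        sq_nonneg (∫ x, Real.cos (t * x) ∂μ - ∫ x, Real.cos (t * x) ∂ν)]
    · have : P t = 0 := hPz ht
      simp only [hP] at this
      nlinarith [sq_nonneg (∫ x, Real.sin (t * x) ∂μ - ∫ x, Real.sin (t * x) ∂ν),
        sq_nonneg (∫ x, Real.cos (t * x) ∂μ - ∫ x, Real.cos (t * x) ∂ν)]

end moments

section energy

variable {α R C a : ℝ}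

theorem rpow_le_two_mul_kernel (hα : 2 < α) {r : ℝ} (hr : 0 ≤ r) :
    r ^ α ≤ 2 * α * ((α⁻¹ * r ^ α - 2⁻¹ * r ^ 2) + 2⁻¹ * (α ^ (1 / (α - 2))) ^ 2) := by
  have hα0 : 0 < α := by linarith
  have hs : 0 < α - 2 := by linarith
  have h0 : 0 < α ^ (1 / (α - 2)) := Real.rpow_pos_of_pos hα0 _
  have e : 2 * α * ((α⁻¹ * r ^ α - 2⁻¹ * r ^ 2) + 2⁻¹ * (α ^ (1 / (α - 2))) ^ 2) =
      2 * r ^ α - α * r ^ 2 + α * (α ^ (1 / (α - 2))) ^ 2 := by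
    field_simp
  rw [e]
  have hp : 0 ≤ r ^ α := Real.rpow_nonneg hr _
  rcases le_total (α ^ (1 / (α - 2))) r with h | h
  · have h1 : α ≤ r ^ (α - 2) := by
      calc α = (α ^ (1 / (α - 2))) ^ (α - 2) := by
            rw [← Real.rpow_mul hα0.le, one_div_mul_cancel hs.ne', Real.rpow_one]
        _ ≤ r ^ (α - 2) := Real.rpow_le_rpow h0.le h hs.le
    have h2 : r ^ α = r ^ (α - 2) * r ^ 2 := by
      rw [← Real.rpow_natCast r 2, ← Real.rpow_add (h0.trans_le h)]
      congr 1
      push_cast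
      ring
    have h3 : α * r ^ 2 ≤ r ^ α := h2 ▸ mul_le_mul_of_nonneg_right h1 (sq_nonneg r)
    have : 0 ≤ α * (α ^ (1 / (α - 2))) ^ 2 := by positivity
    linarith
  · have : r ^ 2 ≤ (α ^ (1 / (α - 2))) ^ 2 := pow_le_pow_left₀ hr h 2
    nlinarith

theorem integrable_abs_rpow_of_integrable_kernel {ν : Measure ℝ} [IsProbabilityMeasure ν]
    (hα : 2 < α) (h : Integrable
      (fun p : ℝ × ℝ => α⁻¹ * |p.1 - p.2| ^ α - 2⁻¹ * |p.1 - p.2| ^ 2) (ν.prod ν)) :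
    Integrable (fun x => |x| ^ α) ν := by
  refine integrable_abs_rpow_of_prod (μ := ν) (by linarith) ?_
  refine Integrable.mono' ((h.add (integrable_const (2⁻¹ * (α ^ (1 / (α - 2))) ^ 2))).const_mul
    (2 * α)) ?_ (Filter.Eventually.of_forall fun p => ?_)
  · exact ((continuous_abs_rpow (by linarith)).comp
      (continuous_fst.sub continuous_snd)).aestronglyMeasurable
  · rw [Real.norm_of_nonneg (by positivity)]
    exact rpow_le_two_mul_kernel hα (abs_nonneg _)

theorem integral_kernel_prod {μ ν : Measure ℝ} [IsProbabilityMeasure μ] [IsProbabilityMeasure ν]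
    (hα : 2 < α) (hμ : Integrable (fun x => |x| ^ α) μ) (hν : Integrable (fun x => |x| ^ α) ν) :
    Integrable (fun p : ℝ × ℝ => α⁻¹ * |p.1 - p.2| ^ α - 2⁻¹ * |p.1 - p.2| ^ 2) (μ.prod ν) ∧
    ∫ p : ℝ × ℝ, (α⁻¹ * |p.1 - p.2| ^ α - 2⁻¹ * |p.1 - p.2| ^ 2) ∂(μ.prod ν) =
      α⁻¹ * ∫ p, |p.1 - p.2| ^ α ∂(μ.prod ν) -
        2⁻¹ * (∫ x, x ^ 2 ∂μ + ∫ x, x ^ 2 ∂ν - 2 * ((∫ x, x ∂μ) * ∫ x, x ∂ν)) := by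
  have i1 := (integrable_abs_sub_rpow (by linarith) hμ hν).const_mul α⁻¹
  obtain ⟨i2, e2⟩ := integral_sub_sq_prod (integrable_of_integrable_abs_rpow (by linarith) hμ)
    (integrable_of_integrable_abs_rpow (by linarith) hν)
    (integrable_sq_of_integrable_abs_rpow hα.le hμ) (integrable_sq_of_integrable_abs_rpow hα.le hν)
  simp only [sq_abs]
  refine ⟨i1.sub (i2.const_mul 2⁻¹), ?_⟩
  rw [integral_sub i1 (i2.const_mul 2⁻¹), integral_const_mul, integral_const_mul, e2]

theorem integrable_abs_rpow_equilibrium [IsFiniteMeasure (equilibrium α R C a)] (hα : 0 ≤ α) :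
    Integrable (fun x => |x| ^ α) (equilibrium α R C a) :=
  integrable_equilibrium (continuous_abs_rpow hα)

theorem energy_equilibrium (hα2 : 2 < α) (hα3 : α < 3) (hR : 0 < R)
    (hC : C = ProbabilityTheory.beta (1 / 2) ((3 - α) / 2))
    (hRC : R ^ (α - 2) * ((α - 1) * ProbabilityTheory.beta ((α - 1) / 2) ((3 - α) / 2)) = C) :
    Integrable (fun p : ℝ × ℝ => α⁻¹ * |p.1 - p.2| ^ α - 2⁻¹ * |p.1 - p.2| ^ 2)
      ((equilibrium α R C a).prod (equilibrium α R C a)) ∧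
    ∫ p : ℝ × ℝ, (α⁻¹ * |p.1 - p.2| ^ α - 2⁻¹ * |p.1 - p.2| ^ 2)
      ∂((equilibrium α R C a).prod (equilibrium α R C a)) =
        -((α - 2) / (α * (4 - α))) * R ^ 2 := by
  have := isProbabilityMeasure_equilibrium (a := a) hα3 hR hC
  have hμ : Integrable (fun x => |x| ^ α) (equilibrium α R C a) :=
    integrable_abs_rpow_equilibrium (by linarith)
  have hi := (integral_kernel_prod hα2 hμ hμ).1
  refine ⟨hi, ?_⟩
  rw [integral_prod _ hi, integral_congr_ae (g := fun _ => -((α - 2) / (α * (4 - α))) * R ^ 2)]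
  · simp
  · filter_upwards [ae_equilibrium] with x hx
    exact (integral_kernel_equilibrium hα2 hα3 hR hC hRC x).2 hx

theorem energy_ge_equilibrium (hα2 : 2 < α) (hα3 : α < 3) (hR : 0 < R)
    (hC : C = ProbabilityTheory.beta (1 / 2) ((3 - α) / 2))
    (hRC : R ^ (α - 2) * ((α - 1) * ProbabilityTheory.beta ((α - 1) / 2) ((3 - α) / 2)) = C)
    {ν : Measure ℝ} [IsProbabilityMeasure ν] (h : Integrable
      (fun p : ℝ × ℝ => α⁻¹ * |p.1 - p.2| ^ α - 2⁻¹ * |p.1 - p.2| ^ 2) (ν.prod ν)) :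
    -((α - 2) / (α * (4 - α))) * R ^ 2 ≤
      ∫ p : ℝ × ℝ, (α⁻¹ * |p.1 - p.2| ^ α - 2⁻¹ * |p.1 - p.2| ^ 2) ∂(ν.prod ν) ∧
    (∫ p : ℝ × ℝ, (α⁻¹ * |p.1 - p.2| ^ α - 2⁻¹ * |p.1 - p.2| ^ 2) ∂(ν.prod ν) =
      -((α - 2) / (α * (4 - α))) * R ^ 2 → ν = equilibrium α R C (∫ x, x ∂ν)) := by
  have hprob := isProbabilityMeasure_equilibrium (a := ∫ x, x ∂ν) hα3 hR hC
  have hmean := integral_id_equilibrium (a := ∫ x, x ∂ν) hα3 hR hC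
  have henergy := (energy_equilibrium (a := ∫ x, x ∂ν) hα2 hα3 hR hC hRC).2
  have hpot := integral_kernel_equilibrium (a := ∫ x, x ∂ν) hα2 hα3 hR hC hRC
  have hμ : Integrable (fun x => |x| ^ α) (equilibrium α R C (∫ x, x ∂ν)) :=
    integrable_abs_rpow_equilibrium (by linarith)
  set μ := equilibrium α R C (∫ x, x ∂ν)
  set m := -((α - 2) / (α * (4 - α))) * R ^ 2
  have hν := integrable_abs_rpow_of_integrable_kernel hα2 h
  obtain ⟨hpos, hzero⟩ := abs_sub_rpow_positive_definite hα2 (by linarith) hν hμ hmean.symm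
  obtain ⟨-, eνν⟩ := integral_kernel_prod hα2 hν hν
  obtain ⟨iνμ, eνμ⟩ := integral_kernel_prod hα2 hν hμ
  obtain ⟨-, eμμ⟩ := integral_kernel_prod hα2 hμ hμ
  have hcross : m ≤ ∫ p : ℝ × ℝ, (α⁻¹ * |p.1 - p.2| ^ α - 2⁻¹ * |p.1 - p.2| ^ 2) ∂(ν.prod μ) := by
    rw [integral_prod _ iνμ]
    calc m = ∫ _, m ∂ν := by simp
      _ ≤ _ := integral_mono (integrable_const m) iνμ.integral_prod_left fun x => (hpot x).1
  rw [hmean] at eνμ eμμ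
  rw [henergy] at eμμ
  have hinv : 0 < α⁻¹ := inv_pos.2 (by linarith)
  set Q := ∫ p, |p.1 - p.2| ^ α ∂(ν.prod ν) - 2 * ∫ p, |p.1 - p.2| ^ α ∂(ν.prod μ) +
    ∫ p, |p.1 - p.2| ^ α ∂(μ.prod μ) with hQ
  have key : ∫ p : ℝ × ℝ, (α⁻¹ * |p.1 - p.2| ^ α - 2⁻¹ * |p.1 - p.2| ^ 2) ∂(ν.prod ν) =
      2 * ∫ p : ℝ × ℝ, (α⁻¹ * |p.1 - p.2| ^ α - 2⁻¹ * |p.1 - p.2| ^ 2) ∂(ν.prod μ) - m +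
        α⁻¹ * Q := by
    rw [eνν, eνμ, hQ]
    linear_combination eμμ
  rw [key]
  have hαQ : 0 ≤ α⁻¹ * Q := mul_nonneg hinv.le hpos
  refine ⟨by linarith, fun heq => hzero ?_⟩
  have : α⁻¹ * Q = 0 := by linarith
  exact (mul_eq_zero.1 this).resolve_left hinv.ne'

theorem equilibrium_constant_eq_beta :
    Real.sqrt π * Real.Gamma ((3 - α) / 2) / Real.Gamma ((4 - α) / 2) =
      ProbabilityTheory.beta (1 / 2) ((3 - α) / 2) := by
  unfold ProbabilityTheory.beta
  rw [Real.Gamma_one_half_eq, show 1 / 2 + (3 - α) / 2 = (4 - α) / 2 by ring]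

theorem equilibrium_radius (hα2 : 2 < α) (hα3 : α < 3)
    (hR : R = ((Real.sqrt π / 2) * (Real.Gamma ((3 - α) / 2) / Real.Gamma ((4 - α) / 2)) *
      (Real.sin ((α - 1) * π / 2) / ((α - 1) * π / 2))) ^ (1 / (α - 2))) :
    0 < R ∧ R ^ (α - 2) * ((α - 1) * ProbabilityTheory.beta ((α - 1) / 2) ((3 - α) / 2)) =
      ProbabilityTheory.beta (1 / 2) ((3 - α) / 2) := by
  have hsin : 0 < Real.sin ((α - 1) * π / 2) :=
    Real.sin_pos_of_pos_of_lt_pi (by nlinarith [Real.pi_pos]) (by nlinarith [Real.pi_pos])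
  have h1 : 0 < α - 1 := by linarith
  have hs : 0 < α - 2 := by linarith
  have hb : (Real.sqrt π / 2) * (Real.Gamma ((3 - α) / 2) / Real.Gamma ((4 - α) / 2)) =
      ProbabilityTheory.beta (1 / 2) ((3 - α) / 2) / 2 := by
    rw [← equilibrium_constant_eq_beta]
    ring
  have hbeta : ProbabilityTheory.beta ((α - 1) / 2) ((3 - α) / 2) =
      π / Real.sin ((α - 1) * π / 2) := by
    unfold ProbabilityTheory.beta
    rw [show (α - 1) / 2 + (3 - α) / 2 = 1 by ring, Real.Gamma_one, div_one,
      show (3 - α) / 2 = 1 - (α - 1) / 2 by ring, Real.Gamma_mul_Gamma_one_sub,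
      show π * ((α - 1) / 2) = (α - 1) * π / 2 by ring]
  rw [hb] at hR
  have hB := beta_one_half_pos (q := (3 - α) / 2) (by linarith)
  set B := ProbabilityTheory.beta (1 / 2) ((3 - α) / 2)
  have hbase : 0 < B / 2 * (Real.sin ((α - 1) * π / 2) / ((α - 1) * π / 2)) := by
    have := Real.pi_pos
    positivity
  refine ⟨hR ▸ Real.rpow_pos_of_pos hbase _, ?_⟩
  rw [hR, ← Real.rpow_mul hbase.le, one_div_mul_cancel hs.ne', Real.rpow_one, hbeta]
  have := Real.pi_pos
  field_simp

end energy

/-- For `2 < α < 3`, the infimum over Borel probability measures `μ` on `ℝ`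
of the interaction energy
`E_α[μ] = (1/2) ∬ (α⁻¹ |x-y|^α - 2⁻¹ |x-y|^2) dμ(x) dμ(y)`
equals `-((α-2)/(2α(4-α))) R_α²`, and it is attained at `μ` if and only if `μ` is a translate
of the explicit absolutely continuous measure with density
`C_α⁻¹ R_α^(α-2) (R_α² - (x-a)²)^(-(α-1)/2) 𝟙(|x-a| < R_α)`. -/
theorem interaction_energy_minimizer_two_lt_alpha_lt_three
    (α : ℝ) (hα2 : 2 < α) (hα3 : α < 3)
    (Rα Cα Eα : ℝ)
    (hR : Rα = ((Real.sqrt π / 2) * (Real.Gamma ((3 - α) / 2) / Real.Gamma ((4 - α) / 2)) *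
      (Real.sin ((α - 1) * π / 2) / ((α - 1) * π / 2))) ^ (1 / (α - 2)))
    (hC : Cα = Real.sqrt π * Real.Gamma ((3 - α) / 2) / Real.Gamma ((4 - α) / 2))
    (hE : Eα = -((α - 2) / (2 * α * (4 - α))) * Rα ^ 2) :
    IsLeast {e : ℝ | ∃ μ : Measure ℝ, IsProbabilityMeasure μ ∧
      Integrable (fun p : ℝ × ℝ => α⁻¹ * |p.1 - p.2| ^ α - 2⁻¹ * |p.1 - p.2| ^ 2) (μ.prod μ) ∧
      e = (1 / 2) * ∫ p : ℝ × ℝ,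
        (α⁻¹ * |p.1 - p.2| ^ α - 2⁻¹ * |p.1 - p.2| ^ 2) ∂(μ.prod μ)} Eα ∧
    ∀ μ : Measure ℝ, IsProbabilityMeasure μ →
      ((Integrable (fun p : ℝ × ℝ => α⁻¹ * |p.1 - p.2| ^ α - 2⁻¹ * |p.1 - p.2| ^ 2) (μ.prod μ) ∧
        (1 / 2) * ∫ p : ℝ × ℝ,
          (α⁻¹ * |p.1 - p.2| ^ α - 2⁻¹ * |p.1 - p.2| ^ 2) ∂(μ.prod μ) = Eα) ↔
        ∃ a : ℝ, μ = volume.withDensity fun x => ENNReal.ofReal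
          (if |x - a| < Rα then Cα⁻¹ * Rα ^ (α - 2) * (Rα ^ 2 - (x - a) ^ 2) ^ (-(α - 1) / 2)
            else 0)) := by
  subst hC
  rw [equilibrium_constant_eq_beta]
  obtain ⟨hR0, hRC⟩ := equilibrium_radius hα2 hα3 hR
  have hE2 : Eα = 1 / 2 * (-((α - 2) / (α * (4 - α))) * Rα ^ 2) := by
    rw [hE, mul_assoc 2 α, div_mul_eq_div_div_swap]
    ring
  have hval := fun a => energy_equilibrium (a := a) hα2 hα3 hR0 rfl hRC
  refine ⟨⟨⟨_, isProbabilityMeasure_equilibrium (a := 0) hα3 hR0 rfl, (hval 0).1, ?_⟩, ?_⟩, ?_⟩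
  · rw [(hval 0).2, hE2]
  · rintro e ⟨ν, hν, hi, rfl⟩
    rw [hE2]
    have := (energy_ge_equilibrium hα2 hα3 hR0 rfl hRC hi).1
    linarith
  · intro ν hν
    constructor
    · rintro ⟨hi, he⟩
      exact ⟨_, (energy_ge_equilibrium hα2 hα3 hR0 rfl hRC hi).2 (by linarith)⟩
    · rintro ⟨a, ha⟩
      change ν = equilibrium α Rα _ a at ha
      subst ha
      exact ⟨(hval a).1, by rw [(hval a).2, hE2]⟩
end

section
/- Let 2 < α < 3. Then for every x ∈ ℝ, ∫_{−1}^{1} |x−y|^α (1−y²)^{−(α−1)/2} dy = α C'_α x² + C'_α + F(x), where F(x) = 0 if |x| ≤ 1 and F(x) = (α(α−1)(α−2)/2) · C_α · ∫_{1}^{|x|} (y²−1)^{−(3−α)/2} (|x|−y)² dy if |x| > 1; here C_α = √π Γ((3-α)/2)/Γ((4-α)/2) and C'_α = ((α-1)π/2)/sin((α-1)π/2). -/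
open MeasureTheory Real

theorem setIntegral_Ioo_zero_one_rpow_mul_one_sub_rpow {p q : ℝ} (hp : 0 < p) (hq : 0 < q) :
    ∫ u in Set.Ioo (0 : ℝ) 1, u ^ (p - 1) * (1 - u) ^ (q - 1) = ProbabilityTheory.beta p q := by
  have hb := ProbabilityTheory.beta_pos hp hq
  have h1 := ProbabilityTheory.lintegral_betaPDF_eq_one hp hq
  rw [ProbabilityTheory.lintegral_betaPDF] at h1
  have h2 : ∫ u in Set.Ioo (0 : ℝ) 1, 1 / ProbabilityTheory.beta p q * u ^ (p - 1) *
      (1 - u) ^ (q - 1) = 1 := by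
    rw [integral_eq_lintegral_of_nonneg_ae, h1, ENNReal.toReal_one]
    · refine (ae_restrict_mem measurableSet_Ioo).mono fun u hu => ?_
      have := hu.1
      have := sub_pos.2 hu.2
      simp only [Pi.zero_apply]
      positivity
    · exact Measurable.aestronglyMeasurable (by fun_prop)
  simp_rw [mul_assoc] at h2
  rw [integral_const_mul] at h2
  field_simp at h2
  linarith

theorem setIntegral_Ioo_neg_one_one_abs_rpow_mul {p q : ℝ} (hp : 0 < p) (hq : 0 < q) :
    ∫ y in Set.Ioo (-1 : ℝ) 1, |y| ^ (2 * p - 1) * (1 - y ^ 2) ^ (q - 1) =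
      ProbabilityTheory.beta p q := by
  have himage : (fun y : ℝ => y ^ 2) '' Set.Ioo 0 1 = Set.Ioo 0 1 := by
    ext u
    constructor
    · rintro ⟨y, ⟨h0, h1⟩, rfl⟩
      exact ⟨by positivity, by dsimp only; nlinarith⟩
    · rintro ⟨h0, h1⟩
      exact ⟨√u, ⟨Real.sqrt_pos.2 h0, by rw [Real.sqrt_lt' one_pos]; simpa using h1⟩,
        Real.sq_sqrt h0.le⟩
  have hsub := integral_image_eq_integral_abs_deriv_smul (s := Set.Ioo (0 : ℝ) 1)
    (f := fun y => y ^ 2) (f' := fun y => 2 * y) measurableSet_Ioo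
    (fun y _ => by simpa using (hasDerivAt_pow 2 y).hasDerivWithinAt)
    (fun a ha b hb hab => by
      exact (sq_eq_sq₀ ha.1.le hb.1.le).1 hab)
    (fun u => u ^ (p - 1) * (1 - u) ^ (q - 1))
  rw [himage, setIntegral_Ioo_zero_one_rpow_mul_one_sub_rpow hp hq] at hsub
  have habs := integral_comp_abs (f := (Set.Iio (1 : ℝ)).indicator
    fun y => y ^ (2 * p - 1) * (1 - y ^ 2) ^ (q - 1))
  rw [setIntegral_indicator measurableSet_Iio, Set.Ioi_inter_Iio] at habs
  rw [← integral_indicator measurableSet_Ioo, hsub]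
  convert habs using 1
  · refine integral_congr_ae (Filter.Eventually.of_forall fun y => ?_)
    by_cases hy : |y| < 1
    · have hy' := abs_lt.1 hy
      simp [Set.indicator_of_mem (show y ∈ Set.Ioo (-1 : ℝ) 1 from hy'),
        Set.indicator_of_mem (show |y| ∈ Set.Iio (1 : ℝ) from hy)]
    · beta_reduce
      rw [Set.indicator_of_notMem (show y ∉ Set.Ioo (-1 : ℝ) 1 from fun h => hy (abs_lt.2 h)),
        Set.indicator_of_notMem (show |y| ∉ Set.Iio (1 : ℝ) from hy)]
  · rw [← integral_const_mul]
    refine setIntegral_congr_fun measurableSet_Ioo fun y hy => ?_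
    have h0 := hy.1
    simp only [smul_eq_mul]
    rw [abs_of_pos (by positivity), ← Real.rpow_natCast y 2, ← Real.rpow_mul h0.le,
      show 2 * p - 1 = ((2 : ℕ) : ℝ) * (p - 1) + 1 by push_cast; ring, Real.rpow_add_one h0.ne']
    ring

theorem hasDerivAt_abs_rpow_of_ne_zero {u : ℝ} (p : ℝ) (hu : u ≠ 0) :
    HasDerivAt (fun v : ℝ => |v| ^ p) (p * (u * |u| ^ (p - 2))) u := by
  have h := (hasDerivAt_abs hu).rpow_const (p := p) (Or.inl (abs_ne_zero.2 hu))
  convert h using 1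
  have h0 := abs_pos.2 hu
  rw [show p - 1 = p - 2 + 1 by ring, Real.rpow_add_one h0.ne']
  have : (SignType.sign u : ℝ) * |u| = u := sign_mul_abs u
  linear_combination (-p * |u| ^ (p - 2)) * this

theorem sq_mul_abs_rpow_sub_two {u : ℝ} (p : ℝ) (hu : u ≠ 0) :
    u ^ 2 * |u| ^ (p - 2) = |u| ^ p := by
  rw [← sq_abs, mul_comm, ← Real.rpow_natCast, ← Real.rpow_add (abs_pos.2 hu)]
  norm_num

theorem intervalIntegrable_mul_abs_rpow {p : ℝ} (hp : -2 < p) (a b : ℝ) :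
    IntervalIntegrable (fun u : ℝ => u * |u| ^ p) volume a b := by
  have hpos : ∀ c : ℝ, 0 ≤ c → IntervalIntegrable (fun u : ℝ => u * |u| ^ p) volume 0 c := by
    intro c hc
    refine (intervalIntegral.intervalIntegrable_rpow' (r := p + 1) (by linarith)).congr ?_
    intro u hu
    rw [Set.uIoc_of_le hc] at hu
    simp only
    rw [abs_of_pos hu.1, Real.rpow_add_one hu.1.ne', mul_comm]
  have hall : ∀ c : ℝ, IntervalIntegrable (fun u : ℝ => u * |u| ^ p) volume 0 c := by
    intro c
    rcases le_total 0 c with hc | hc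
    · exact hpos c hc
    · have := (hpos (-c) (by linarith)).neg
      rw [IntervalIntegrable.iff_comp_neg]
      convert this using 1
      · ext u
        simp
      · simp
  exact (hall a).symm.trans (hall b)

/-- Taylor's formula of order two with integral remainder for `s ↦ |s - y| ^ α` at `0`. -/
theorem abs_sub_rpow_eq_taylor {α : ℝ} (hα : 2 < α) {x : ℝ} (hx : 0 ≤ x) (y : ℝ) :
    |x - y| ^ α = |y| ^ α - α * x * (y * |y| ^ (α - 2)) +
      α * (α - 1) / 2 * x ^ 2 * |y| ^ (α - 2) +
      α * (α - 1) * (α - 2) / 2 *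
        ∫ s in Set.Ioc 0 x, (x - s) ^ 2 * ((s - y) * |s - y| ^ (α - 4)) := by
  rw [← intervalIntegral.integral_of_le hx, ← intervalIntegral.integral_const_mul]
  have key := integral_eq_of_hasDerivAt_off_countable_of_le
    (fun s => |s - y| ^ α + α * (x - s) * ((s - y) * |s - y| ^ (α - 2)) +
      α * (α - 1) / 2 * (x - s) ^ 2 * |s - y| ^ (α - 2))
    (fun s => α * (α - 1) * (α - 2) / 2 * ((x - s) ^ 2 * ((s - y) * |s - y| ^ (α - 4))))
    hx (Set.countable_singleton y) ?_ ?_ ?_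
  · rw [key]
    simp
    ring
  · have h1 : Continuous fun s : ℝ => |s - y| ^ α :=
      (continuous_abs.comp (continuous_id.sub continuous_const)).rpow_const
        fun _ => Or.inr (by linarith)
    have h2 : Continuous fun s : ℝ => |s - y| ^ (α - 2) :=
      (continuous_abs.comp (continuous_id.sub continuous_const)).rpow_const
        fun _ => Or.inr (by linarith)
    exact Continuous.continuousOn (by fun_prop)
  · rintro s ⟨-, hs⟩
    have hne : s - y ≠ 0 := sub_ne_zero.2 hs
    have hsub := (hasDerivAt_id s).sub_const y
    have h0 := HasDerivAt.comp s (hasDerivAt_abs_rpow_of_ne_zero α hne) hsub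
    have h2 := HasDerivAt.comp s (hasDerivAt_abs_rpow_of_ne_zero (α - 2) hne) hsub
    have hx' := (hasDerivAt_id s).const_sub x
    have := (h0.add ((hx'.const_mul α).mul (hsub.mul h2))).add
      (((hx'.pow 2).const_mul (α * (α - 1) / 2)).mul h2)
    convert this using 1
    · rfl
    have e := sq_mul_abs_rpow_sub_two (α - 2) hne
    simp only [show α - 2 - 2 = α - 4 by ring] at e ⊢
    simp
    linear_combination (-α * (α - 2) * (x - s)) * e
  · have hk := (intervalIntegrable_mul_abs_rpow (p := α - 4) (by linarith)
      (0 - y) (x - y)).comp_sub_right y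
    simp only [sub_add_cancel] at hk
    refine IntervalIntegrable.const_mul (hk.continuousOn_mul ?_) _
    exact Continuous.continuousOn (by fun_prop)
theorem inversion_weight_identity {α D r q : ℝ} (hD : 0 < D) (hr : 0 < r) (hq : 0 < q) :
    D / r ^ 2 * ((D / r) ^ (α - 3) * (D * q / r ^ 2) ^ (-(α - 1) / 2)) =
      D ^ (-(3 - α) / 2) * q ^ (-(α - 1) / 2) := by
  rw [Real.div_rpow hD.le hr.le, Real.div_rpow (by positivity) (by positivity),
    Real.mul_rpow hD.le hq.le, ← Real.rpow_natCast r 2, ← Real.rpow_mul hr.le,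
    show -(3 - α) / 2 = 1 + (α - 3) + -(α - 1) / 2 by ring, Real.rpow_add hD, Real.rpow_add hD,
    Real.rpow_one]
  have h : r ^ ((2 : ℕ) : ℝ) * (r ^ (α - 3) * r ^ (((2 : ℕ) : ℝ) * (-(α - 1) / 2))) = 1 := by
    rw [← Real.rpow_add hr, ← Real.rpow_add hr]
    convert Real.rpow_zero r using 2
    push_cast
    ring
  calc _ = D * D ^ (α - 3) * D ^ (-(α - 1) / 2) * q ^ (-(α - 1) / 2) /
      (r ^ ((2 : ℕ) : ℝ) * (r ^ (α - 3) * r ^ (((2 : ℕ) : ℝ) * (-(α - 1) / 2)))) := by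
        field_simp
    _ = _ := by rw [h, div_one]

theorem hasDerivAt_inversion {s t : ℝ} (h : s - t ≠ 0) :
    HasDerivAt (fun t => (1 - s * t) / (s - t)) ((1 - s ^ 2) / (s - t) ^ 2) t := by
  have h1 := ((hasDerivAt_id t).const_mul s).const_sub 1
  have h2 := (hasDerivAt_id t).const_sub s
  refine (h1.fun_div h2 h).congr_deriv ?_
  simp only [id]
  ring

theorem inversion_inversion {s t : ℝ} (hs : 1 - s ^ 2 ≠ 0) (h : s - t ≠ 0) :
    (1 - s * ((1 - s * t) / (s - t))) / (s - (1 - s * t) / (s - t)) = t := by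
  have e1 : 1 - s * ((1 - s * t) / (s - t)) = -(1 - s ^ 2) * t / (s - t) := by
    field_simp
    ring
  have e2 : s - (1 - s * t) / (s - t) = -(1 - s ^ 2) / (s - t) := by
    field_simp
    ring
  rw [e1, e2]
  field_simp

theorem sub_inversion {s t : ℝ} (h : s - t ≠ 0) :
    s - (1 - s * t) / (s - t) = (s ^ 2 - 1) / (s - t) := by
  field_simp
  ring

theorem one_sub_inversion_sq {s t : ℝ} (h : s - t ≠ 0) :
    1 - ((1 - s * t) / (s - t)) ^ 2 = (s ^ 2 - 1) * (1 - t ^ 2) / (s - t) ^ 2 := by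
  field_simp
  ring

theorem mul_abs_rpow_sub_four {u : ℝ} (α : ℝ) (hu : u ≠ 0) :
    u * |u| ^ (α - 4) = u / |u| * |u| ^ (α - 3) := by
  rw [show α - 3 = α - 4 + 1 by ring, Real.rpow_add_one (abs_ne_zero.2 hu)]
  field_simp [abs_ne_zero.2 hu]

theorem setIntegral_inversion {s : ℝ} (hs : 1 - s ^ 2 ≠ 0) {S T : Set ℝ} (hSm : MeasurableSet S)
    (hS : ∀ t ∈ S, s - t ≠ 0) (hT : ∀ t ∈ T, s - t ≠ 0)
    (hST : Set.MapsTo (fun t => (1 - s * t) / (s - t)) S T)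
    (hTS : Set.MapsTo (fun t => (1 - s * t) / (s - t)) T S) (g : ℝ → ℝ) :
    ∫ y in T, g y = ∫ t in S, |1 - s ^ 2| / (s - t) ^ 2 * g ((1 - s * t) / (s - t)) := by
  have himage : (fun t => (1 - s * t) / (s - t)) '' S = T :=
    hST.image_subset.antisymm fun y hy => ⟨_, hTS hy, inversion_inversion hs (hT y hy)⟩
  rw [← himage, integral_image_eq_integral_abs_deriv_smul hSm
    (fun t ht => (hasDerivAt_inversion (hS t ht)).hasDerivWithinAt)
    (Set.LeftInvOn.injOn (f₁' := fun t => (1 - s * t) / (s - t))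
      fun t ht => inversion_inversion hs (hS t ht))]
  simp [abs_div]

theorem setIntegral_kernel_of_one_lt {α s : ℝ} (hs : 1 < s) :
    ∫ y in Set.Ioo (-1 : ℝ) 1, (s - y) * |s - y| ^ (α - 4) * (1 - y ^ 2) ^ (-(α - 1) / 2) =
      (s ^ 2 - 1) ^ (-(3 - α) / 2) *
        ∫ y in Set.Ioo (-1 : ℝ) 1, (1 - y ^ 2) ^ (-(α - 1) / 2) := by
  have hD : 0 < s ^ 2 - 1 := by nlinarith
  have hne : ∀ t ∈ Set.Ioo (-1 : ℝ) 1, s - t ≠ 0 := fun t ht => by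
    have := ht.2
    exact (by linarith : 0 < s - t).ne'
  have hmaps : Set.MapsTo (fun t => (1 - s * t) / (s - t)) (Set.Ioo (-1) 1) (Set.Ioo (-1) 1) := by
    rintro t ⟨h1, h2⟩
    have hr : 0 < s - t := by linarith
    constructor
    · rw [lt_div_iff₀ hr]
      nlinarith
    · rw [div_lt_iff₀ hr]
      nlinarith
  rw [setIntegral_inversion (by linarith) measurableSet_Ioo hne hne hmaps hmaps,
    ← integral_const_mul]
  refine setIntegral_congr_fun measurableSet_Ioo fun t ht => ?_
  have hr : 0 < s - t := by linarith [ht.2]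
  have hq : 0 < 1 - t ^ 2 := by nlinarith [ht.1, ht.2]
  have hDr := div_pos hD hr
  rw [← inversion_weight_identity hD hr hq, sub_inversion hr.ne', one_sub_inversion_sq hr.ne',
    mul_abs_rpow_sub_four α hDr.ne', abs_of_pos hDr, div_self hDr.ne', one_mul,
    abs_sub_comm, abs_of_pos hD]

theorem setIntegral_kernel_of_abs_lt_one {α s : ℝ} (hs0 : -1 < s) (hs : s < 1) :
    ∫ y in Set.Ioo (-1 : ℝ) 1, (s - y) * |s - y| ^ (α - 4) * (1 - y ^ 2) ^ (-(α - 1) / 2) = 0 := by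
  have hD : 0 < 1 - s ^ 2 := by nlinarith
  have hSm : MeasurableSet {t : ℝ | 1 < t ^ 2} := by measurability
  have hSne : ∀ t ∈ {t : ℝ | 1 < t ^ 2}, s - t ≠ 0 := by
    intro t (ht : 1 < t ^ 2) h
    rw [← sub_eq_zero.1 h] at ht
    linarith
  have hTne : ∀ t ∈ Set.Ioo (-1 : ℝ) 1 \ {s}, s - t ≠ 0 := fun t ht h =>
    ht.2 (sub_eq_zero.1 h).symm
  have hST : Set.MapsTo (fun t => (1 - s * t) / (s - t)) {t : ℝ | 1 < t ^ 2}
      (Set.Ioo (-1 : ℝ) 1 \ {s}) := by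
    intro t ht
    have hr := hSne t ht
    have ht' : 1 < t ^ 2 := ht
    refine ⟨?_, fun h => ?_⟩
    · have h1 : 0 < 1 - ((1 - s * t) / (s - t)) ^ 2 := by
        rw [one_sub_inversion_sq hr]
        exact div_pos (mul_pos_of_neg_of_neg (by linarith) (by linarith)) (by positivity)
      exact abs_lt.1 ((sq_lt_one_iff_abs_lt_one _).1 (by linarith))
    · have h2 := sub_inversion hr
      rw [Set.mem_singleton_iff] at h
      beta_reduce at h
      rw [h, sub_self, eq_comm, div_eq_zero_iff] at h2
      rcases h2 with h2 | h2
      · linarith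
      · exact hr h2
  have hTS : Set.MapsTo (fun t => (1 - s * t) / (s - t)) (Set.Ioo (-1 : ℝ) 1 \ {s})
      {t : ℝ | 1 < t ^ 2} := by
    intro t ht
    have hr := hTne t ht
    have h1 : 1 - ((1 - s * t) / (s - t)) ^ 2 < 0 := by
      rw [one_sub_inversion_sq hr]
      exact div_neg_of_neg_of_pos
        (mul_neg_of_neg_of_pos (by linarith) (by nlinarith [ht.1.1, ht.1.2])) (by positivity)
    exact sub_neg.1 h1
  have hdiff : (Set.Ioo (-1 : ℝ) 1 \ {s} : Set ℝ) =ᵐ[volume] Set.Ioo (-1 : ℝ) 1 :=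
    sdiff_null_ae_eq_self (by simp)
  rw [← setIntegral_congr_set hdiff, setIntegral_inversion hD.ne' hSm hSne hTne hST hTS]
  have hodd : ∀ t ∈ {t : ℝ | 1 < t ^ 2},
      |1 - s ^ 2| / (s - t) ^ 2 * ((s - (1 - s * t) / (s - t)) *
        |s - (1 - s * t) / (s - t)| ^ (α - 4) *
        (1 - ((1 - s * t) / (s - t)) ^ 2) ^ (-(α - 1) / 2)) =
      t / |t| * ((1 - s ^ 2) ^ (-(3 - α) / 2) * (t ^ 2 - 1) ^ (-(α - 1) / 2)) := by
    intro t ht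
    have hr := hSne t ht
    have hr' := abs_pos.2 hr
    have hq : 0 < t ^ 2 - 1 := sub_pos.2 ht
    have ht0 : t ≠ 0 := by rintro rfl; norm_num at hq
    have hu : (s ^ 2 - 1) / (s - t) ≠ 0 := div_ne_zero (by linarith) hr
    have habs : |(s ^ 2 - 1) / (s - t)| = (1 - s ^ 2) / |s - t| := by
      rw [abs_div, abs_sub_comm, abs_of_pos hD]
    have hsign : (s ^ 2 - 1) / (s - t) / |(s ^ 2 - 1) / (s - t)| = t / |t| := by
      rw [habs]
      rcases lt_or_gt_of_ne ht0 with h | h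
      · have : 0 < s - t := by nlinarith
        rw [abs_of_pos this, abs_of_neg h, div_neg, div_self ht0, div_div_div_cancel_right₀ hr,
          ← neg_sub, neg_div, div_self hD.ne']
      · have : s - t < 0 := by nlinarith
        rw [abs_of_neg this, abs_of_pos h, div_self ht0, div_neg, div_neg,
          div_div_div_cancel_right₀ hr, ← neg_sub, neg_div, div_self hD.ne', neg_neg]
    rw [← inversion_weight_identity hD hr' hq, sub_inversion hr, one_sub_inversion_sq hr,
      mul_abs_rpow_sub_four α hu, hsign, habs, sq_abs, abs_of_pos hD,
      show (s ^ 2 - 1) * (1 - t ^ 2) = (1 - s ^ 2) * (t ^ 2 - 1) by ring]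
    ring
  rw [setIntegral_congr_fun hSm hodd, ← integral_indicator hSm]
  rw [← self_eq_neg, ← integral_neg, ← integral_neg_eq_self]
  refine integral_congr_ae (Filter.Eventually.of_forall fun t => ?_)
  simp only [Set.indicator, Set.mem_ofPred_eq, neg_sq, abs_neg]
  split_ifs <;> ring

theorem integrableOn_one_sub_sq_rpow {p : ℝ} (hp : -1 < p) :
    IntegrableOn (fun y : ℝ => (1 - y ^ 2) ^ p) (Set.Ioo (-1) 1) := by
  have hb := setIntegral_Ioo_neg_one_one_abs_rpow_mul (p := 1 / 2) (q := p + 1) (by norm_num)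
    (by linarith)
  norm_num at hb
  by_contra h
  rw [integral_undef h] at hb
  exact (ProbabilityTheory.beta_pos (by norm_num) (by linarith)).ne hb

theorem integrable_prod_kernel {α : ℝ} (hα2 : 2 < α) (hα3 : α < 3) (x : ℝ) :
    Integrable (Function.uncurry fun s y : ℝ => (x - s) ^ 2 *
      ((s - y) * |s - y| ^ (α - 4) * (1 - y ^ 2) ^ (-(α - 1) / 2)))
      ((volume.restrict (Set.Ioc 0 x)).prod (volume.restrict (Set.Ioo (-1) 1))) := by
  have hw := (integrableOn_one_sub_sq_rpow (p := -(α - 1) / 2) (by linarith)).integrable_indicator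
    measurableSet_Ioo
  have hk : Integrable ((Set.Ioc (-1) (max (x + 1) (-1))).indicator
      fun u : ℝ => u * |u| ^ (α - 4)) := by
    refine IntegrableOn.integrable_indicator ?_ measurableSet_Ioc
    rw [← intervalIntegrable_iff_integrableOn_Ioc_of_le (le_max_right _ _)]
    exact intervalIntegrable_mul_abs_rpow (by linarith) _ _
  have hconv := (hw.convolution_integrand (ContinuousLinearMap.mul ℝ ℝ) hk).integrableOn
    (s := Set.Ioc 0 x ×ˢ Set.Ioo (-1) 1)
  have hbdd := hconv.bdd_mul (f := fun p : ℝ × ℝ => (x - p.1) ^ 2) (c := x ^ 2)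
    (Continuous.aestronglyMeasurable (by fun_prop))
    ((ae_restrict_mem (measurableSet_Ioc.prod measurableSet_Ioo)).mono fun p hp => by
      have h1 := hp.1.1
      have h2 := hp.1.2
      rw [Real.norm_of_nonneg (sq_nonneg _)]
      nlinarith)
  rw [Measure.prod_restrict]
  refine hbdd.congr ((ae_restrict_mem (measurableSet_Ioc.prod measurableSet_Ioo)).mono ?_)
  rintro ⟨s, y⟩ ⟨hs, hy⟩
  dsimp only at hs hy
  have hsy : s - y ∈ Set.Ioc (-1) (max (x + 1) (-1)) :=
    ⟨by linarith [hs.1, hy.2], le_max_of_le_left (by linarith [hs.2, hy.1])⟩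
  simp only [Function.uncurry, ContinuousLinearMap.mul_apply', Set.indicator_of_mem hy,
    Set.indicator_of_mem hsy]
  ring

theorem setIntegral_abs_sub_rpow_mul_eq {α : ℝ} (hα2 : 2 < α) (hα3 : α < 3) {x : ℝ}
    (hx : 0 ≤ x) :
    ∫ y in Set.Ioo (-1 : ℝ) 1, |x - y| ^ α * (1 - y ^ 2) ^ (-(α - 1) / 2) =
      ProbabilityTheory.beta ((α + 1) / 2) ((3 - α) / 2) +
      α * (α - 1) / 2 * x ^ 2 * ProbabilityTheory.beta ((α - 1) / 2) ((3 - α) / 2) +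
      α * (α - 1) * (α - 2) / 2 * ∫ s in Set.Ioc 0 x, (x - s) ^ 2 *
        ∫ y in Set.Ioo (-1 : ℝ) 1,
          (s - y) * |s - y| ^ (α - 4) * (1 - y ^ 2) ^ (-(α - 1) / 2) := by
  have hw := integrableOn_one_sub_sq_rpow (p := -(α - 1) / 2) (by linarith)
  have hpow : ∀ p : ℝ, 0 ≤ p → IntegrableOn
      (fun y : ℝ => |y| ^ p * (1 - y ^ 2) ^ (-(α - 1) / 2)) (Set.Ioo (-1) 1) := by
    intro p hp
    refine hw.bdd_mul (c := 1) (Measurable.aestronglyMeasurable (by fun_prop))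
      ((ae_restrict_mem measurableSet_Ioo).mono fun y hy => ?_)
    rw [Real.norm_of_nonneg (by positivity)]
    exact Real.rpow_le_one (abs_nonneg y) (abs_lt.2 hy).le hp
  have hodd : IntegrableOn (fun y : ℝ => y * (|y| ^ (α - 2) * (1 - y ^ 2) ^ (-(α - 1) / 2)))
      (Set.Ioo (-1) 1) :=
    (hpow (α - 2) (by linarith)).bdd_mul (c := 1) (Measurable.aestronglyMeasurable (by fun_prop))
      ((ae_restrict_mem measurableSet_Ioo).mono fun y hy => (abs_lt.2 hy).le)
  have hodd0 : ∫ y in Set.Ioo (-1 : ℝ) 1,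
      y * (|y| ^ (α - 2) * (1 - y ^ 2) ^ (-(α - 1) / 2)) = 0 := by
    rw [← integral_Ioc_eq_integral_Ioo, ← intervalIntegral.integral_of_le (by norm_num)]
    have h := intervalIntegral.integral_comp_neg (a := -1) (b := 1)
      fun y : ℝ => y * (|y| ^ (α - 2) * (1 - y ^ 2) ^ (-(α - 1) / 2))
    simp only [abs_neg, neg_sq, neg_mul, neg_neg, intervalIntegral.integral_neg] at h
    linarith
  have hprod := integrable_prod_kernel hα2 hα3 x
  have hrem := hprod.integral_prod_right
  have hswap := integral_integral_swap hprod
  simp only [Function.uncurry] at hrem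
  have hb1 := setIntegral_Ioo_neg_one_one_abs_rpow_mul (p := (α + 1) / 2) (q := (3 - α) / 2)
    (by linarith) (by linarith)
  have hb2 := setIntegral_Ioo_neg_one_one_abs_rpow_mul (p := (α - 1) / 2) (q := (3 - α) / 2)
    (by linarith) (by linarith)
  rw [show 2 * ((α + 1) / 2) - 1 = α by ring, show (3 - α) / 2 - 1 = -(α - 1) / 2 by ring] at hb1
  rw [show 2 * ((α - 1) / 2) - 1 = α - 2 by ring,
    show (3 - α) / 2 - 1 = -(α - 1) / 2 by ring] at hb2
  have hI1 := hpow α (by linarith)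
  have hI2 := (hpow (α - 2) (by linarith)).const_mul (α * (α - 1) / 2 * x ^ 2)
  have hI3 := hodd.const_mul (α * x)
  have hI4 := hrem.const_mul (α * (α - 1) * (α - 2) / 2)
  simp_rw [← integral_const_mul ((x - _) ^ 2)]
  have hsum := integral_add' ((hI1.sub hI3).add hI2) hI4
  rw [integral_add' (hI1.sub hI3) hI2, integral_sub' hI1 hI3, integral_const_mul,
    integral_const_mul, integral_const_mul, hodd0, hb1, hb2, mul_zero, sub_zero, ← hswap] at hsum
  rw [← hsum]
  refine integral_congr_ae (Filter.Eventually.of_forall fun y => ?_)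
  simp only [Pi.add_apply, Pi.sub_apply, ← mul_assoc]
  rw [integral_mul_const, abs_sub_rpow_eq_taylor hα2 hx y]
  simp only [← mul_assoc]
  ring

theorem setIntegral_remainder_eq (α x : ℝ) :
    ∫ s in Set.Ioc 0 x, (x - s) ^ 2 * ∫ y in Set.Ioo (-1 : ℝ) 1,
        (s - y) * |s - y| ^ (α - 4) * (1 - y ^ 2) ^ (-(α - 1) / 2) =
      (∫ y in Set.Ioo (-1 : ℝ) 1, (1 - y ^ 2) ^ (-(α - 1) / 2)) *
        ∫ s in Set.Ioc 1 x, (s ^ 2 - 1) ^ (-(3 - α) / 2) * (x - s) ^ 2 := by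
  have hset : Set.Ioc (0 : ℝ) x ∩ Set.Ioi 1 = Set.Ioc 1 x := by
    ext s
    simp only [Set.mem_inter_iff, Set.mem_Ioc, Set.mem_Ioi]
    constructor
    · rintro ⟨⟨-, h1⟩, h2⟩
      exact ⟨h2, h1⟩
    · rintro ⟨h1, h2⟩
      exact ⟨⟨by linarith, h2⟩, h1⟩
  rw [← hset, ← setIntegral_indicator measurableSet_Ioi, ← integral_const_mul]
  refine setIntegral_congr_ae measurableSet_Ioc ?_
  filter_upwards [compl_mem_ae_iff.2 (measure_singleton (μ := volume) (1 : ℝ))] with s hs1 hs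
  rcases lt_or_gt_of_ne (show s ≠ 1 from hs1) with h | h
  · rw [setIntegral_kernel_of_abs_lt_one (by linarith [hs.1]) h,
      Set.indicator_of_notMem (by simpa using h.le), mul_zero, mul_zero]
  · rw [setIntegral_kernel_of_one_lt h, Set.indicator_of_mem (by simpa using h)]
    ring

theorem beta_half_sub_half (α : ℝ) :
    ProbabilityTheory.beta ((α - 1) / 2) ((3 - α) / 2) = π / sin ((α - 1) * π / 2) := by
  rw [ProbabilityTheory.beta, show (α - 1) / 2 + (3 - α) / 2 = 1 by ring, Real.Gamma_one, div_one,
    show (3 - α) / 2 = 1 - (α - 1) / 2 by ring, Real.Gamma_mul_Gamma_one_sub]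
  congr 2
  ring

theorem beta_half_add_half {α : ℝ} (hα : 1 < α) :
    ProbabilityTheory.beta ((α + 1) / 2) ((3 - α) / 2) =
      (α - 1) / 2 * ProbabilityTheory.beta ((α - 1) / 2) ((3 - α) / 2) := by
  rw [ProbabilityTheory.beta, ProbabilityTheory.beta,
    show (α + 1) / 2 + (3 - α) / 2 = 1 + 1 by ring,
    show (α - 1) / 2 + (3 - α) / 2 = 1 by ring, show (α + 1) / 2 = (α - 1) / 2 + 1 by ring,
    Real.Gamma_add_one (by linarith), Real.Gamma_add_one one_ne_zero, Real.Gamma_one]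
  ring

theorem setIntegral_one_sub_sq_rpow {α : ℝ} (hα : α < 3) :
    ∫ y in Set.Ioo (-1 : ℝ) 1, (1 - y ^ 2) ^ (-(α - 1) / 2) =
      √π * Real.Gamma ((3 - α) / 2) / Real.Gamma ((4 - α) / 2) := by
  have hb := setIntegral_Ioo_neg_one_one_abs_rpow_mul (p := 1 / 2) (q := (3 - α) / 2)
    (by norm_num) (by linarith)
  rw [ProbabilityTheory.beta, Real.Gamma_one_half_eq, show 1 / 2 + (3 - α) / 2 = (4 - α) / 2 by ring,
    show (3 - α) / 2 - 1 = -(α - 1) / 2 by ring] at hb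
  simpa using hb

/-- Lemma 2.2. For `2 < α < 3` and all `x ∈ ℝ`,
`∫_{-1}^{1} |x-y|^α (1-y²)^{-(α-1)/2} dy = α C'_α x² + C'_α + F(x)`,
where `F(x) = 0` for `|x| ≤ 1` and
`F(x) = (α(α-1)(α-2)/2) C_α ∫_1^{|x|} (y²-1)^{-(3-α)/2} (|x|-y)² dy` for `|x| > 1`. -/
theorem integral_abs_rpow_kernel_two_lt_alpha_lt_three
    (α : ℝ) (hα2 : 2 < α) (hα3 : α < 3)
    (Cα Cα' : ℝ)
    (hC : Cα = Real.sqrt π * Real.Gamma ((3 - α) / 2) / Real.Gamma ((4 - α) / 2))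
    (hC' : Cα' = ((α - 1) * π / 2) / Real.sin ((α - 1) * π / 2)) :
    ∀ x : ℝ, (∫ y in (-1 : ℝ)..1, |x - y| ^ α * (1 - y ^ 2) ^ (-(α - 1) / 2)) =
      α * Cα' * x ^ 2 + Cα' +
        (if |x| ≤ 1 then 0 else
          α * (α - 1) * (α - 2) / 2 * Cα *
            ∫ y in (1 : ℝ)..|x|, (y ^ 2 - 1) ^ (-(3 - α) / 2) * (|x| - y) ^ 2) := by
  have hnonneg : ∀ x : ℝ, 0 ≤ x →
      (∫ y in (-1 : ℝ)..1, |x - y| ^ α * (1 - y ^ 2) ^ (-(α - 1) / 2)) =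
      α * Cα' * x ^ 2 + Cα' +
        (if x ≤ 1 then 0 else
          α * (α - 1) * (α - 2) / 2 * Cα *
            ∫ y in (1 : ℝ)..x, (y ^ 2 - 1) ^ (-(3 - α) / 2) * (x - y) ^ 2) := by
    intro x hx
    rw [intervalIntegral.integral_of_le (by norm_num), integral_Ioc_eq_integral_Ioo,
      setIntegral_abs_sub_rpow_mul_eq hα2 hα3 hx, setIntegral_remainder_eq,
      setIntegral_one_sub_sq_rpow hα3, ← hC, beta_half_add_half (by linarith),
      beta_half_sub_half, show (α - 1) * π / 2 = (α - 1) / 2 * π by ring, mul_div_assoc] at *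
    split_ifs with h
    · rw [Set.Ioc_eq_empty (not_lt.2 h)]
      simp [hC']
      ring
    · rw [intervalIntegral.integral_of_le (not_le.1 h).le, hC']
      ring
  intro x
  have h := hnonneg |x| (abs_nonneg x)
  rw [sq_abs] at h
  rw [← h]
  rcases abs_cases x with ⟨hx, -⟩ | ⟨hx, -⟩
  · rw [hx]
  · rw [hx]
    have hneg := intervalIntegral.integral_comp_neg (a := -1) (b := 1)
      fun y : ℝ => |x - y| ^ α * (1 - y ^ 2) ^ (-(α - 1) / 2)
    rw [neg_neg] at hneg
    rw [← hneg]
    refine intervalIntegral.integral_congr fun y _ => ?_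
    simp only [neg_sq]
    rw [show x - -y = -(-x - y) by ring, abs_neg]
end
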